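/- Let F = ℚ(√d) with d ≥ 6 squarefree and let H be a totally definite quaternion F-algebra. Then t(H, D₆) = 1 if H is F-isomorphic to the quaternion algebra (−1,−3/F) and 3ε ∈ F^{×2}, and t(H, D₆) = 0 otherwise. (Here D₆ is the dihedral group of order 12.) -/

import Mathlib

open NumberField Quaternion

noncomputable section

namespace QuatPaper

variable (F : Type) [Field F] [NumberField F]

def scalarSet (H : Type) [Ring H] [Algebra F H] : Set H :=
  Set.range fun r : 𝓞 F => algebraMap F H (algebraMap (𝓞 F) F r)

def IsOrder {H : Type} [Ring H] [Algebra F H] (O : Subring H) : Prop :=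
  scalarSet F H ⊆ ↑O ∧ O.toAddSubgroup.FG ∧ Submodule.span F (O : Set H) = ⊤

def IsMaximalOrder {H : Type} [Ring H] [Algebra F H] (O : Subring H) : Prop :=
  IsOrder F O ∧ ∀ O' : Subring H, IsOrder F O' → O ≤ O' → O' = O

def IsScalarUnit {H : Type} [Ring H] [Algebra F H] {O : Subring H} (u : (↥O)ˣ) : Prop :=
  ∃ r : (𝓞 F)ˣ, ((u : ↥O) : H) = algebraMap F H (algebraMap (𝓞 F) F ↑r)

def RedUnitIso {H : Type} [Ring H] [Algebra F H] (O : Subring H) (G : Type*) [Group G] : Prop :=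
  ∃ φ : (↥O)ˣ →* G, Function.Surjective φ ∧ ∀ u, φ u = 1 ↔ IsScalarUnit F u

def IsConjugate {H : Type} [Ring H] (x : Hˣ) (O O' : Subring H) : Prop :=
  ∀ y : H, y ∈ O ↔ (x : H) * y * ((x⁻¹ : Hˣ) : H) ∈ O'

def ConjRel {H : Type} [Ring H] (O O' : Subring H) : Prop :=
  ∃ x : Hˣ, IsConjugate x O O'

def typeNum (H : Type) [Ring H] [Algebra F H] (G : Type*) [Group G] : ℕ :=
  Nat.card (Quot fun O O' : {O : Subring H // IsMaximalOrder F O ∧ RedUnitIso F O G} =>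
    ConjRel O.1 O'.1)

def IsQuatAlg (H : Type) [Ring H] [Algebra F H] : Prop :=
  ∃ a b : F, a ≠ 0 ∧ b ≠ 0 ∧ Nonempty (H ≃ₐ[F] ℍ[F, a, b])

def TotallyDefinite (H : Type) [Ring H] [Algebra F H] : Prop :=
  ∀ σ : F →+* ℝ,
    letI : Algebra F ℝ := σ.toAlgebra
    ∀ x : TensorProduct F ℝ H, x ≠ 0 → IsUnit x

section QuadraticField

variable {F}
variable {d : ℕ} {sqrtd : F}

lemma exists_rat_repr (hsqrtd : sqrtd ^ 2 = (d : F)) (hgen : Algebra.adjoin ℚ {sqrtd} = ⊤) (x : F) :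
    ∃ p q : ℚ, x = p + q * sqrtd := by
  have hx : x ∈ Algebra.adjoin ℚ {sqrtd} := by rw [hgen]; trivial
  induction hx using Algebra.adjoin_induction with
  | mem y hy =>
    rw [Set.mem_singleton_iff] at hy
    exact ⟨0, 1, by simp [hy]⟩
  | algebraMap r => exact ⟨r, 0, by simp⟩
  | add x y _ _ hx hy =>
    obtain ⟨p, q, rfl⟩ := hx
    obtain ⟨p', q', rfl⟩ := hy
    exact ⟨p + p', q + q', by push_cast; ring⟩
  | mul x y _ _ hx hy =>
    obtain ⟨p, q, rfl⟩ := hx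
    obtain ⟨p', q', rfl⟩ := hy
    exact ⟨p * p' + q * q' * d, p * q' + q * p', by
      push_cast; linear_combination (q * q' : F) * hsqrtd⟩

lemma rat_repr_eq_zero (hd6 : 6 ≤ d) (hdsf : Squarefree d) (hsqrtd : sqrtd ^ 2 = (d : F))
    {p q : ℚ} (h : (p : F) + q * sqrtd = 0) : p = 0 ∧ q = 0 := by
  have hq : q = 0 := by
    by_contra hq
    have h1 : (d : ℚ) = (p / q) * (p / q) := by
      have h2 : (p : F) ^ 2 = q ^ 2 * d := by
        rw [← hsqrtd, eq_neg_of_add_eq_zero_left h]; ring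
      have h3 : p ^ 2 = q ^ 2 * d := by exact_mod_cast h2
      field_simp
      linarith
    obtain ⟨m, hm⟩ := Rat.isSquare_natCast_iff.1 ⟨_, h1⟩
    have := hdsf m ⟨1, by rw [hm]; ring⟩
    rw [Nat.isUnit_iff] at this
    subst this
    omega
  subst hq
  simpa using h

lemma rat_repr_inj (hd6 : 6 ≤ d) (hdsf : Squarefree d) (hsqrtd : sqrtd ^ 2 = (d : F))
    {p q p' q' : ℚ} (h : (p : F) + q * sqrtd = p' + q' * sqrtd) : p = p' ∧ q = q' := by
  have := rat_repr_eq_zero (p := p - p') (q := q - q') hd6 hdsf hsqrtd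
    (by push_cast; linear_combination h)
  exact ⟨sub_eq_zero.1 this.1, sub_eq_zero.1 this.2⟩

lemma exists_conj (hd6 : 6 ≤ d) (hdsf : Squarefree d) (hsqrtd : sqrtd ^ 2 = (d : F))
    (hgen : Algebra.adjoin ℚ {sqrtd} = ⊤) : ∃ s : F →+* F, s sqrtd = -sqrtd := by
  choose p q hpq using exists_rat_repr hsqrtd hgen
  have key : ∀ (x : F) (a b : ℚ), x = a + b * sqrtd → p x = a ∧ q x = b := fun x a b h =>
    rat_repr_inj hd6 hdsf hsqrtd ((hpq x).symm.trans h)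
  refine ⟨RingHom.mk' ⟨⟨fun x => p x - q x * sqrtd, ?_⟩, ?_⟩ ?_, ?_⟩
  · obtain ⟨h1, h2⟩ := key 1 1 0 (by simp)
    simp [h1, h2]
  · intro x y
    obtain ⟨h1, h2⟩ := key (x * y) (p x * p y + q x * q y * d) (p x * q y + q x * p y) (by
      conv_lhs => rw [hpq x, hpq y]
      push_cast; linear_combination (q x * q y : F) * hsqrtd)
    simp only [h1, h2]
    push_cast; linear_combination (-q x * q y : F) * hsqrtd
  · intro x y
    obtain ⟨h1, h2⟩ := key (x + y) (p x + p y) (q x + q y) (by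
      conv_lhs => rw [hpq x, hpq y]
      push_cast; ring)
    simp only [MonoidHom.coe_mk, OneHom.coe_mk, h1, h2]
    push_cast; ring
  · obtain ⟨h1, h2⟩ := key sqrtd 0 1 (by simp)
    simp [RingHom.mk', h1, h2]

lemma three_ne_sq (hd6 : 6 ≤ d) (hdsf : Squarefree d) (hsqrtd : sqrtd ^ 2 = (d : F))
    (hgen : Algebra.adjoin ℚ {sqrtd} = ⊤) (x : F) : x ^ 2 ≠ 3 := by
  intro hx
  obtain ⟨p, q, rfl⟩ := exists_rat_repr hsqrtd hgen x
  obtain ⟨h1, h2⟩ := rat_repr_eq_zero (p := p ^ 2 + q ^ 2 * d - 3) (q := 2 * p * q)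
    hd6 hdsf hsqrtd (by push_cast; linear_combination hx - (q ^ 2 : F) * hsqrtd)
  have aux : ∀ (m : ℕ), 3 * d ≠ m * m := by
    intro m hm
    have h3 : 3 ∣ m := by
      have : 3 ∣ m * m := ⟨d, hm.symm⟩
      rcases (Nat.Prime.dvd_mul Nat.prime_three).1 this with h | h <;> exact h
    obtain ⟨k, rfl⟩ := h3
    have hk : d = 3 * (k * k) := by nlinarith
    have := hdsf k ⟨3, by rw [hk]; ring⟩
    rw [Nat.isUnit_iff] at this
    subst this
    omega
  have h2' : p = 0 ∨ q = 0 := by simpa using h2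
  rcases h2' with rfl | rfl
  · obtain ⟨m, hm⟩ := (Rat.isSquare_natCast_iff (n := 3 * d)).1 ⟨q * d, by
      push_cast; linear_combination (-d : ℚ) * h1⟩
    exact aux m hm
  · obtain ⟨m, hm⟩ := (Rat.isSquare_natCast_iff (n := 3)).1 ⟨p, by
      push_cast; linear_combination -h1⟩
    have : m < 2 := by nlinarith
    interval_cases m <;> omega

/-- An integer of a real quadratic field of radicand at least `6`, all of whose conjugates lie in
`[-2, 2]`, is a rational integer. -/
lemma integral_of_abs_le_two (hd6 : 6 ≤ d) (hdsf : Squarefree d) (hsqrtd : sqrtd ^ 2 = (d : F))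
    (hgen : Algebra.adjoin ℚ {sqrtd} = ⊤) (σ₀ : F →+* ℝ)
    {s : F →+* F} (hs : s sqrtd = -sqrtd) {x : F} (hx : IsIntegral ℤ x)
    (h₀ : |σ₀ x| ≤ 2) (h₁ : |σ₀ (s x)| ≤ 2) :
    x = 0 ∨ x = 1 ∨ x = -1 ∨ x = 2 ∨ x = -2 := by
  obtain ⟨p, q, rfl⟩ := exists_rat_repr hsqrtd hgen x
  have hsx : s ((p : F) + q * sqrtd) = p - q * sqrtd := by simp [hs]; ring
  have hx' : IsIntegral ℤ ((p : F) - q * sqrtd) := by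
    rw [← hsx]; exact hx.map (s.toIntAlgHom)
  have ratint : ∀ r : ℚ, IsIntegral ℤ (r : F) → ∃ m : ℤ, r = m := by
    intro r hr
    have h : IsIntegral ℤ (algebraMap ℚ F r) := by simpa using hr
    rw [isIntegral_algebraMap_iff (algebraMap ℚ F).injective] at h
    obtain ⟨m, hm⟩ := IsIntegrallyClosed.isIntegral_iff.1 h
    exact ⟨m, by simpa using hm.symm⟩
  obtain ⟨M, hM⟩ := ratint (2 * p) (by
    have h : ((2 * p : ℚ) : F) = (p + q * sqrtd) + (p - q * sqrtd) := by push_cast; ring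
    rw [h]; exact hx.add hx')
  obtain ⟨N, hN⟩ := ratint (p ^ 2 - d * q ^ 2) (by
    have h : ((p ^ 2 - d * q ^ 2 : ℚ) : F) = (p + q * sqrtd) * (p - q * sqrtd) := by
      push_cast; linear_combination (q : F) ^ 2 * hsqrtd
    rw [h]; exact hx.mul hx')
  obtain ⟨Q, hQ⟩ : ∃ Q : ℤ, 2 * q = Q := by
    have h1 : (d : ℚ) * (2 * q) ^ 2 = ((M ^ 2 - 4 * N : ℤ) : ℚ) := by
      push_cast; rw [← hM, ← hN]; ring
    set r := 2 * q with hr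
    have h2 : (d : ℤ) * r.num ^ 2 = (M ^ 2 - 4 * N) * (r.den : ℤ) ^ 2 := by
      have h3 : (d : ℚ) * (r.num : ℚ) ^ 2 = ((M ^ 2 - 4 * N : ℤ) : ℚ) * (r.den : ℚ) ^ 2 := by
        rw [← h1, ← Rat.mul_den_eq_num r]; ring
      exact_mod_cast h3
    have hcop : IsCoprime ((r.den : ℤ) ^ 2) (r.num ^ 2) := by
      apply IsCoprime.pow
      rw [Int.isCoprime_iff_gcd_eq_one, Int.gcd_comm]
      simpa [Int.gcd] using r.reduced
    have h3 : (r.den : ℤ) ^ 2 ∣ (d : ℤ) :=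
      hcop.dvd_of_dvd_mul_right ⟨M ^ 2 - 4 * N, by rw [h2]; ring⟩
    have h4 : r.den * r.den ∣ d := by
      have : ((r.den * r.den : ℕ) : ℤ) ∣ (d : ℤ) := by push_cast; rwa [← sq]
      exact_mod_cast this
    have h5 := Nat.isUnit_iff.1 (hdsf _ h4)
    exact ⟨r.num, by conv_lhs => rw [← Rat.num_div_den r, h5]; simp⟩
  have hrel : M ^ 2 - 4 * N = d * Q ^ 2 := by
    have : (M : ℚ) ^ 2 - 4 * N = d * Q ^ 2 := by rw [← hM, ← hN, ← hQ]; ring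
    exact_mod_cast this
  rw [hsx] at h₁
  have hp : (p : ℝ) = M / 2 := by
    have : (p : ℚ) = M / 2 := by linarith
    rw [this]; push_cast; ring
  have hq : (q : ℝ) = Q / 2 := by
    have : (q : ℚ) = Q / 2 := by linarith
    rw [this]; push_cast; ring
  have hσ : σ₀ sqrtd ^ 2 = d := by rw [← map_pow, hsqrtd]; simp
  simp only [map_add, map_sub, map_mul, map_ratCast] at h₀ h₁
  rw [hp, hq, abs_le] at h₀ h₁
  set v := (Q : ℝ) * σ₀ sqrtd with hv
  have hv2 : v ^ 2 = (Q : ℝ) ^ 2 * d := by rw [hv, mul_pow, hσ]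
  have hMabs : |(M : ℝ)| ≤ 4 := by rw [abs_le]; constructor <;> nlinarith
  have hMv : |v| ≤ 4 - |(M : ℝ)| := by
    rcases abs_cases (M : ℝ) with ⟨h, _⟩ | ⟨h, _⟩ <;> rw [h, abs_le] <;>
      constructor <;> nlinarith
  have hbound : (Q : ℝ) ^ 2 * d ≤ (4 - |(M : ℝ)|) ^ 2 := by
    rw [← hv2, ← sq_abs v]
    exact pow_le_pow_left₀ (abs_nonneg _) hMv 2
  have hboundZ : Q ^ 2 * d ≤ (4 - |M|) ^ 2 := by exact_mod_cast hbound
  have hMZ : |M| ≤ 4 := by exact_mod_cast hMabs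
  have hd4 : ¬ (4 : ℕ) ∣ d := fun h => by
    have := hdsf 2 (by simpa using h)
    rw [Nat.isUnit_iff] at this; omega
  have hd9 : d ≠ 9 := fun h => by
    have := hdsf 3 (by simp [h])
    rw [Nat.isUnit_iff] at this; omega
  have hQ0 : Q = 0 := by
    by_contra hne
    have hQ1 : 1 ≤ Q ^ 2 := by
      have := sq_pos_of_ne_zero hne; omega
    have hd6' : (6 : ℤ) ≤ d := by exact_mod_cast hd6
    have hM1 : |M| ≤ 1 := by nlinarith [abs_nonneg M]
    have hQ2 : Q ^ 2 ≤ 2 := by nlinarith [abs_nonneg M]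
    have hQeq : Q ^ 2 = 1 := by
      have h : |Q| ≤ 1 := by
        by_contra! h
        nlinarith [sq_abs Q]
      nlinarith [sq_abs Q, abs_nonneg Q]
    rw [hQeq] at hrel hboundZ
    obtain ⟨hl, hr⟩ := abs_le.1 hM1
    have : M = -1 ∨ M = 0 ∨ M = 1 := by omega
    rcases this with rfl | rfl | rfl
    · norm_num at hrel hboundZ; omega
    · norm_num at hrel hboundZ; omega
    · norm_num at hrel hboundZ; omega
  subst hQ0
  have hq0 : q = 0 := by simpa using hQ
  subst hq0
  obtain ⟨hl, hr⟩ := abs_le.1 hMZ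
  have hrel' : M ^ 2 = 4 * N := by linarith [hrel]
  have hM2 : Even M := by
    have : Even (M ^ 2) := ⟨2 * N, by linarith⟩
    exact (Int.even_pow.1 this).1
  obtain ⟨k, rfl⟩ := hM2
  have hpk : p = k := by push_cast at hM; linarith
  subst hpk
  have : k = 0 ∨ k = 1 ∨ k = -1 ∨ k = 2 ∨ k = -2 := by omega
  rcases this with rfl | rfl | rfl | rfl | rfl <;> simp

omit [NumberField F] in
lemma eq_zpow_of_pos (σ₀ : F →+* ℝ) {ε : (𝓞 F)ˣ} (hε : 1 < σ₀ (algebraMap (𝓞 F) F ↑ε))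
    (hεfund : ∀ u : (𝓞 F)ˣ, 1 < σ₀ (algebraMap (𝓞 F) F ↑u) →
      σ₀ (algebraMap (𝓞 F) F ↑ε) ≤ σ₀ (algebraMap (𝓞 F) F ↑u))
    (v : (𝓞 F)ˣ) (hv : 0 < σ₀ (algebraMap (𝓞 F) F ↑v)) : ∃ k : ℤ, v = ε ^ k := by
  let f : (𝓞 F)ˣ →* ℝˣ := Units.map (σ₀.comp (algebraMap (𝓞 F) F)).toMonoidHom
  have hf : ∀ u, (f u : ℝ) = σ₀ (algebraMap (𝓞 F) F ↑u) := fun u => rfl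
  obtain ⟨k, hk1, hk2⟩ := exists_mem_Ico_zpow hv hε
  refine ⟨k, ?_⟩
  have hpos : 0 < σ₀ (algebraMap (𝓞 F) F ↑ε) := by linarith
  have hval : σ₀ (algebraMap (𝓞 F) F ↑(v * ε ^ (-k))) =
      σ₀ (algebraMap (𝓞 F) F ↑v) * (σ₀ (algebraMap (𝓞 F) F ↑ε) ^ k)⁻¹ := by
    rw [← hf, ← hf, ← hf, map_mul, map_zpow, Units.val_mul, Units.val_zpow_eq_zpow_val, zpow_neg]
  have hpk := zpow_pos hpos k
  have h1 : 1 ≤ σ₀ (algebraMap (𝓞 F) F ↑(v * ε ^ (-k))) := by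
    rw [hval, ← div_eq_mul_inv, le_div_iff₀ hpk, one_mul]; exact hk1
  have h2 : σ₀ (algebraMap (𝓞 F) F ↑(v * ε ^ (-k))) < σ₀ (algebraMap (𝓞 F) F ↑ε) := by
    rw [hval, ← div_eq_mul_inv, div_lt_iff₀ hpk, mul_comm, ← zpow_add_one₀ hpos.ne']; exact hk2
  have h3 : σ₀ (algebraMap (𝓞 F) F ↑(v * ε ^ (-k))) = 1 := by
    by_contra hne
    exact absurd (hεfund _ (lt_of_le_of_ne h1 (Ne.symm hne))) (not_le.2 h2)
  have h4 : v * ε ^ (-k) = 1 := by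
    apply Units.ext
    apply (FaithfulSMul.algebraMap_injective (𝓞 F) F)
    apply σ₀.injective
    rw [h3]; simp
  rw [zpow_neg] at h4
  exact mul_inv_eq_one.1 h4

end QuadraticField

section ReducedTrace

variable {F} {H : Type} [Ring H] [Algebra F H]

/-- A reduced trace on a quaternion algebra: a trace form such that every element is a root of
a quadratic polynomial with the prescribed linear coefficient. -/
def IsRedTrace (T : H →ₗ[F] F) : Prop :=
  (∀ x y, T (x * y) = T (y * x)) ∧ T 1 = 2 ∧
    ∀ x, ∃ n : F, x * x = T x • x - algebraMap F H n

omit [NumberField F] in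
lemma exists_isRedTrace {a b c : F} (e : H ≃ₐ[F] ℍ[F, a, b, c]) :
    ∃ T : H →ₗ[F] F, IsRedTrace T ∧ ∀ x, T x = 2 * (e x).re + b * (e x).imI := by
  refine ⟨((2 : F) • QuaternionAlgebra.reₗ a b c + b • QuaternionAlgebra.imIₗ a b c) ∘ₗ
    e.toLinearMap, ⟨?_, ?_, ?_⟩, fun x => by simp⟩
  · intro x y
    simp
    ring
  · simp
  · intro x
    refine ⟨(e x * star (e x)).re, ?_⟩
    apply e.injective
    rw [map_sub, map_smul, map_mul, AlgEquiv.commutes]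
    ext <;> simp <;> ring

omit [NumberField F] in
lemma finrank_eq_four (hquat : IsQuatAlg F H) : Module.finrank F H = 4 := by
  obtain ⟨a, b, -, -, ⟨e⟩⟩ := hquat
  rw [e.toLinearEquiv.finrank_eq, QuaternionAlgebra.finrank_eq_four]

omit [NumberField F] in
lemma isIntegral_of_mem_order {O : Subring H} (hO : IsOrder F O) {x : H} (hx : x ∈ O) :
    IsIntegral ℤ x := by
  refine IsIntegral.of_mem_of_fg (subalgebraOfSubring O) ?_ x hx
  rw [Submodule.fg_iff_addSubgroup_fg]
  exact hO.2.1

omit [NumberField F] in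
lemma isIntegral_of_redTrace [Nontrivial H] {T : H →ₗ[F] F} (hT : IsRedTrace T) {x : H} {n : F}
    (hn : x * x = T x • x - algebraMap F H n) (hx : IsIntegral ℤ x) :
    IsIntegral ℤ (T x) ∧ IsIntegral ℤ n := by
  by_cases hsc : ∃ r : F, x = algebraMap F H r
  · obtain ⟨r, rfl⟩ := hsc
    have hr : IsIntegral ℤ r := (isIntegral_algebraMap_iff (algebraMap F H).injective).1 hx
    have hTr : T (algebraMap F H r) = 2 * r := by
      rw [Algebra.algebraMap_eq_smul_one, map_smul, hT.2.1, smul_eq_mul, mul_comm]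
    have hnr : n = r * r := by
      rw [hTr, Algebra.smul_def, ← map_mul, ← map_mul, ← map_sub] at hn
      have := (algebraMap F H).injective hn
      linear_combination this
    rw [hTr, hnr]
    refine ⟨?_, hr.mul hr⟩
    rw [two_mul]
    exact hr.add hr
  · obtain ⟨p, hpm, hp⟩ := hx
    open Polynomial in
    set P : F[X] := X ^ 2 - C (T x) * X + C n with hP
    have hPdeg : P.natDegree = 2 := by rw [hP]; compute_degree!
    have hPm : P.Monic := by rw [hP]; monicity!
    have hPx : Polynomial.aeval x P = 0 := by
      rw [hP]
      simp [sq, hn, Algebra.smul_def]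
    have hdvd : P ∣ p.map (algebraMap ℤ F) := by
      have hpx : Polynomial.aeval x (p.map (algebraMap ℤ F)) = 0 := by
        rw [Polynomial.aeval_map_algebraMap]; exact hp
      rw [← Polynomial.modByMonic_eq_zero_iff_dvd hPm]
      set R := p.map (algebraMap ℤ F) %ₘ P with hR
      have hRx : Polynomial.aeval x R = 0 := by
        have h := Polynomial.modByMonic_add_div (p.map (algebraMap ℤ F)) P
        have h2 := congrArg (Polynomial.aeval x) h
        rw [map_add, map_mul, hPx, zero_mul, add_zero, hpx] at h2
        exact h2
      have hRdeg : R.natDegree ≤ 1 := by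
        have := Polynomial.natDegree_modByMonic_lt (p.map (algebraMap ℤ F)) hPm (by
          intro h; rw [h] at hPdeg; simp at hPdeg)
        rw [hPdeg] at this
        exact Nat.lt_succ_iff.1 this
      rw [Polynomial.eq_X_add_C_of_natDegree_le_one hRdeg] at hRx ⊢
      simp only [map_add, map_mul, Polynomial.aeval_C, Polynomial.aeval_X] at hRx
      have h1 : R.coeff 1 = 0 := by
        by_contra h1
        refine hsc ⟨-(R.coeff 1)⁻¹ * R.coeff 0, ?_⟩
        have h2 : algebraMap F H (R.coeff 1)⁻¹ * (algebraMap F H (R.coeff 1) * x) = x := by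
          rw [← mul_assoc, ← map_mul, inv_mul_cancel₀ h1, map_one, one_mul]
        rw [← h2, eq_neg_of_add_eq_zero_left hRx]
        simp
      rw [h1] at hRx ⊢
      have h0 : R.coeff 0 = 0 := by
        rw [map_zero, zero_mul, zero_add] at hRx
        exact (map_eq_zero_iff _ (algebraMap F H).injective).1 hRx
      rw [h0]; simp
    have hinteg := fun i => Polynomial.isIntegral_coeff_of_dvd p P hpm hPm hdvd i
    constructor
    · have := hinteg 1
      rw [hP] at this
      simpa [Polynomial.coeff_X, Polynomial.coeff_C] using this
    · have := hinteg 0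
      rw [hP] at this
      simpa [Polynomial.coeff_X, Polynomial.coeff_C] using this

omit [NumberField F] in
lemma neg_of_sq_scalar (hdef : TotallyDefinite F H) (σ : F →+* ℝ) {x : H} {c : F}
    (hx : ∀ r : F, x ≠ algebraMap F H r) (hxx : x * x = algebraMap F H c) : σ c < 0 := by
  by_contra! hc
  let : Algebra F ℝ := σ.toAlgebra
  have hdef' : ∀ z : TensorProduct F ℝ H, z ≠ 0 → IsUnit z := hdef σ
  obtain ⟨f, hf1, hfx⟩ : ∃ f : H →ₗ[F] F, f x ≠ 0 ∧ f 1 = 0 := by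
    have hmem : x ∉ Submodule.span F {(1 : H)} := by
      rw [Submodule.mem_span_singleton]
      rintro ⟨r, hr⟩
      exact hx r (by rw [← hr, Algebra.algebraMap_eq_smul_one])
    obtain ⟨f, hf, hf'⟩ := Submodule.exists_dual_map_eq_bot_of_notMem hmem inferInstance
    refine ⟨f, hf, ?_⟩
    have : f 1 ∈ (Submodule.span F {(1 : H)}).map f :=
      Submodule.mem_map_of_mem (Submodule.subset_span rfl)
    rwa [hf', Submodule.mem_bot] at this
  let g : TensorProduct F ℝ H →ₗ[F] ℝ :=
    TensorProduct.lift ((LinearMap.mul F ℝ).compl₂ (Algebra.linearMap F ℝ ∘ₗ f))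
  have hg : ∀ (r : ℝ) (h : H), g (r ⊗ₜ h) = r * σ (f h) := fun r h => rfl
  have hne : ∀ r : ℝ, (r ⊗ₜ 1 : TensorProduct F ℝ H) + 1 ⊗ₜ x ≠ 0 := by
    intro r h
    have h2 := congrArg g h
    rw [map_add, hg, hg, map_zero, hfx, map_zero, mul_zero, zero_add, one_mul] at h2
    exact hf1 ((map_eq_zero σ).1 h2)
  set ρ := Real.sqrt (σ c)
  have hρ : ρ * ρ = σ c := Real.mul_self_sqrt hc
  have hprod : ((ρ ⊗ₜ 1 : TensorProduct F ℝ H) + 1 ⊗ₜ x) * ((-ρ) ⊗ₜ 1 + 1 ⊗ₜ x) = 0 := by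
    have h3 : (1 : ℝ) ⊗ₜ[F] (algebraMap F H c) = (σ c) ⊗ₜ[F] (1 : H) := by
      rw [Algebra.algebraMap_eq_smul_one, TensorProduct.tmul_smul, TensorProduct.smul_tmul',
        Algebra.smul_def, mul_one]
      rfl
    simp only [add_mul, mul_add, Algebra.TensorProduct.tmul_mul_tmul, mul_one, one_mul, hxx, h3]
    rw [mul_neg, hρ, TensorProduct.neg_tmul, TensorProduct.neg_tmul]
    abel
  obtain ⟨v, hv⟩ := hdef' _ (hne ρ)
  rw [← hv, Units.mul_right_eq_zero] at hprod
  exact hne _ hprod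

end ReducedTrace

section UnitsOfOrders

variable {F} {H : Type} [Ring H] [Algebra F H] [Nontrivial H]

omit [NumberField F] [Nontrivial H] in
lemma algebraMap_mem_order {O : Subring H} (hO : IsOrder F O) (r : 𝓞 F) :
    algebraMap F H (algebraMap (𝓞 F) F r) ∈ O := hO.1 ⟨r, rfl⟩

omit [NumberField F] in
lemma ne_zero_of_unit {T : H →ₗ[F] F} (hT : IsRedTrace T) {x y : H} (hxy : y * x = 1) {n : F}
    (hn : x * x = T x • x - algebraMap F H n) : n ≠ 0 := by
  rintro rfl
  have hx : x = T x • 1 := by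
    have := congrArg (y * ·) hn
    simpa [← mul_assoc, hxy] using this
  have hT0 : T x = 0 := by
    have h := congrArg T hx
    rw [map_smul, hT.2.1, smul_eq_mul] at h
    linear_combination -h
  rw [hT0, zero_smul] at hx
  rw [hx, mul_zero] at hxy
  exact zero_ne_one hxy

omit [NumberField F] in
lemma inv_quadratic {T : H →ₗ[F] F} (hT : IsRedTrace T) {x y : H} (hxy : x * y = 1)
    (hyx : y * x = 1) {n : F} (hn : x * x = T x • x - algebraMap F H n) :
    y * y = T y • y - algebraMap F H n⁻¹ := by
  have hn0 := ne_zero_of_unit hT hyx hn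
  have h1 : n • y = T x • 1 - x := by
    have := congrArg (y * ·) hn
    simp only [← mul_assoc, hyx, one_mul, mul_sub, mul_smul_comm] at this
    rw [Algebra.algebraMap_eq_smul_one, mul_smul_comm, mul_one] at this
    exact eq_sub_of_add_eq' (eq_sub_iff_add_eq.1 this)
  have h2 : n * T y = T x := by
    have := congrArg T h1
    rw [map_smul, map_sub, map_smul, hT.2.1, smul_eq_mul, smul_eq_mul] at this
    linear_combination this
  have h3 : n • (y * y) = T x • y - 1 := by
    rw [← smul_mul_assoc, h1, sub_mul, smul_mul_assoc, one_mul, hxy]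
  have h4 : n • (y * y) = n • (T y • y - algebraMap F H n⁻¹) := by
    rw [h3, smul_sub, smul_smul, h2, Algebra.algebraMap_eq_smul_one, smul_smul,
      mul_inv_cancel₀ hn0, one_smul]
  exact smul_right_injective H hn0 h4

omit [NumberField F] in
/-- The reduced norm of a unit of an order is a unit. -/
lemma exists_unit_eq_norm {T : H →ₗ[F] F} (hT : IsRedTrace T) {O : Subring H} (hO : IsOrder F O)
    (v : (↥O)ˣ) {n : F} (hn : (v : H) * v = T v • (v : H) - algebraMap F H n) :
    ∃ η : (𝓞 F)ˣ, algebraMap (𝓞 F) F η = n := by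
  have hvy : ((v : O) : H) * ((v⁻¹ : (↥O)ˣ) : O) = 1 := by
    rw [← Subring.coe_mul]; simp
  have hyv : (((v⁻¹ : (↥O)ˣ) : O) : H) * ((v : O) : H) = 1 := by
    rw [← Subring.coe_mul]; simp
  have hn0 := ne_zero_of_unit hT hyv hn
  have hinteg := (isIntegral_of_redTrace hT hn (isIntegral_of_mem_order hO (v : O).2)).2
  have hinteg' := (isIntegral_of_redTrace hT (inv_quadratic hT hvy hyv hn)
    (isIntegral_of_mem_order hO ((v⁻¹ : (↥O)ˣ) : O).2)).2
  refine ⟨⟨⟨n, hinteg⟩, ⟨n⁻¹, hinteg'⟩, ?_, ?_⟩, rfl⟩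
  · ext; exact mul_inv_cancel₀ hn0
  · ext; exact inv_mul_cancel₀ hn0

omit [NumberField F] in
lemma isScalarUnit_iff {O : Subring H} (hO : IsOrder F O) (v : (↥O)ˣ) :
    IsScalarUnit F v ↔ ∃ r : F, ((v : O) : H) = algebraMap F H r := by
  constructor
  · rintro ⟨r, hr⟩
    exact ⟨_, hr⟩
  rintro ⟨r, hr⟩
  have hvy : ((v : O) : H) * ((v⁻¹ : (↥O)ˣ) : O) = 1 := by
    rw [← Subring.coe_mul]; simp
  have hr0 : r ≠ 0 := by
    rintro rfl
    rw [hr, map_zero, zero_mul] at hvy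
    exact zero_ne_one hvy
  have hy : (((v⁻¹ : (↥O)ˣ) : O) : H) = algebraMap F H r⁻¹ := by
    rw [hr] at hvy
    rw [← one_mul (((v⁻¹ : (↥O)ˣ) : O) : H), ← map_one (algebraMap F H), ← inv_mul_cancel₀ hr0,
      map_mul, mul_assoc, hvy, mul_one]
  have hinteg : IsIntegral ℤ r := (isIntegral_algebraMap_iff (algebraMap F H).injective).1
    (hr ▸ isIntegral_of_mem_order hO (v : O).2)
  have hinteg' : IsIntegral ℤ r⁻¹ := (isIntegral_algebraMap_iff (algebraMap F H).injective).1
    (hy ▸ isIntegral_of_mem_order hO ((v⁻¹ : (↥O)ˣ) : O).2)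
  refine ⟨⟨⟨r, hinteg⟩, ⟨r⁻¹, hinteg'⟩, ?_, ?_⟩, hr⟩
  · ext; exact mul_inv_cancel₀ hr0
  · ext; exact inv_mul_cancel₀ hr0

omit [NumberField F] [Nontrivial H] in
lemma coeff_eq_zero_of_scalar {x : H} (hx : ∀ r : F, x ≠ algebraMap F H r) {a b r : F}
    (h : a • x + b • (1 : H) = algebraMap F H r) : a = 0 := by
  by_contra ha
  refine hx (a⁻¹ * (r - b)) ?_
  have h2 : a • x = algebraMap F H (r - b) := by
    rw [map_sub, ← h, Algebra.algebraMap_eq_smul_one b]; abel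
  rw [map_mul, ← h2, ← Algebra.smul_def, smul_smul, inv_mul_cancel₀ ha, one_smul]

omit [NumberField F] [Nontrivial H] in
/-- An element of order exactly `6` modulo scalars satisfies `tr ^ 2 = 3 nr`. -/
lemma trace_sq_eq_three_norm {x : H} {τ n : F}
    (hn : x * x = τ • x - algebraMap F H n) (h2 : ∀ r : F, x ^ 2 ≠ algebraMap F H r)
    (h3 : ∀ r : F, x ^ 3 ≠ algebraMap F H r) {r : F} (h6 : x ^ 6 = algebraMap F H r) :
    τ ≠ 0 ∧ τ ^ 2 = 3 * n := by
  have hx : ∀ r : F, x ≠ algebraMap F H r := by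
    rintro r rfl
    exact h2 (r ^ 2) (by rw [map_pow])
  rw [Algebra.algebraMap_eq_smul_one] at hn
  have hτ : τ ≠ 0 := by
    rintro rfl
    refine h2 (-n) ?_
    rw [sq, hn, Algebra.algebraMap_eq_smul_one]; module
  have hx3 : x ^ 3 = (τ ^ 2 - n) • x + (-(τ * n)) • (1 : H) := by
    rw [pow_succ, sq, hn, sub_mul, smul_mul_assoc, hn, smul_mul_assoc, one_mul]
    module
  have hα : τ ^ 2 - n ≠ 0 := by
    intro h
    refine h3 (-(τ * n)) ?_
    rw [hx3, h, Algebra.algebraMap_eq_smul_one]; module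
  refine ⟨hτ, ?_⟩
  set α := τ ^ 2 - n with hαd
  set β := -(τ * n) with hβ
  have hx6 : x ^ 6 = (α ^ 2 * τ + 2 * α * β) • x + (β ^ 2 - α ^ 2 * n) • (1 : H) := by
    rw [show 6 = 3 + 3 from rfl, pow_add, hx3]
    simp only [add_mul, mul_add, smul_mul_assoc, mul_smul_comm, one_mul, mul_one, hn]
    module
  have h0 := coeff_eq_zero_of_scalar hx (hx6.symm.trans h6)
  have h1 : α * (τ * (τ ^ 2 - 3 * n)) = 0 := by
    rw [← h0, hαd, hβ]; ring
  have h5 := (mul_eq_zero.1 ((mul_eq_zero.1 h1).resolve_left hα)).resolve_left hτ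
  linear_combination h5

omit [NumberField F] in
/-- A dihedral relation modulo scalars is an honest conjugation relation. -/
lemma conj_relation {T : H →ₗ[F] F} (hT : IsRedTrace T) {x w v : H} {n s : F}
    (hn : x * x = T x • x - algebraMap F H n) (hn0 : n ≠ 0) (hτ : T x ≠ 0)
    (hvw : v * w = 1) (hs : x * w * x * v = algebraMap F H s) :
    w * x = T x • w - x * w := by
  set X := w * x * v with hX
  rw [Algebra.algebraMap_eq_smul_one] at hn hs
  have h1 : x * X = s • 1 := by rw [hX, ← hs]; noncomm_ring
  have h2 : (T x • 1 - x) * x = n • 1 := by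
    rw [sub_mul, smul_mul_assoc, one_mul, hn]; abel
  have h3 : n • X = s • (T x • 1 - x) := by
    have := congrArg ((T x • 1 - x) * ·) h1
    simp only [← mul_assoc, h2, mul_smul_comm, smul_mul_assoc, one_mul, mul_one] at this
    exact this
  have hTX : T X = T x := by
    rw [hX, hT.1, ← mul_assoc, hvw, one_mul]
  have hns : n = s := by
    have := congrArg T h3
    rw [map_smul, map_smul, map_sub, map_smul, hT.2.1, hTX, smul_eq_mul, smul_eq_mul,
      smul_eq_mul] at this
    apply mul_right_cancel₀ hτ
    linear_combination this
  subst hns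
  have h4 : X = T x • 1 - x := smul_right_injective H hn0 h3
  calc w * x = X * w := by rw [hX, mul_assoc, hvw, mul_one]
    _ = _ := by rw [h4, sub_mul, smul_mul_assoc, one_mul]

omit [NumberField F] in
lemma exists_basis_of_redUnitIso {T : H →ₗ[F] F} (hT : IsRedTrace T) (hdef : TotallyDefinite F H)
    (h3 : ∀ x : F, x ^ 2 ≠ 3)
    (σ₀ : F →+* ℝ) {ε : (𝓞 F)ˣ} (hε : 1 < σ₀ (algebraMap (𝓞 F) F ↑ε))
    (hεfund : ∀ u : (𝓞 F)ˣ, 1 < σ₀ (algebraMap (𝓞 F) F ↑u) →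
      σ₀ (algebraMap (𝓞 F) F ↑ε) ≤ σ₀ (algebraMap (𝓞 F) F ↑u))
    {O : Subring H} (hO : IsOrder F O) (hG : RedUnitIso F O (DihedralGroup 6)) :
    ∃ t : F, 3 * algebraMap (𝓞 F) F ↑ε = t ^ 2 ∧
      ∃ q : QuaternionAlgebra.Basis H (-algebraMap (𝓞 F) F ↑ε) t (-1), q.i ∈ O ∧ q.j ∈ O := by
  obtain ⟨φ, hφs, hφk⟩ := hG
  have hker : ∀ v, φ v = 1 ↔ ∃ r : F, ((v : O) : H) = algebraMap F H r :=
    fun v => (hφk v).trans (isScalarUnit_iff hO v)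
  obtain ⟨u, hu⟩ := hφs (DihedralGroup.r 1)
  obtain ⟨w, hw⟩ := hφs (DihedralGroup.sr 0)
  set U : H := ((u : O) : H) with hU
  set W : H := ((w : O) : H) with hW
  have hU2 : ∀ r : F, U ^ 2 ≠ algebraMap F H r := by
    intro r hr
    have h := (hker (u ^ 2)).2 ⟨r, by push_cast; exact hr⟩
    rw [map_pow, hu] at h
    revert h; decide
  have hU3 : ∀ r : F, U ^ 3 ≠ algebraMap F H r := by
    intro r hr
    have h := (hker (u ^ 3)).2 ⟨r, by push_cast; exact hr⟩
    rw [map_pow, hu] at h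
    revert h; decide
  obtain ⟨r6, hU6⟩ : ∃ r : F, U ^ 6 = algebraMap F H r := by
    obtain ⟨r, hr⟩ := (hker (u ^ 6)).1 (by rw [map_pow, hu]; decide)
    exact ⟨r, by push_cast at hr; exact hr⟩
  have hW1 : ∀ r : F, W ≠ algebraMap F H r := by
    intro r hr
    have h := (hker w).2 ⟨r, hr⟩
    rw [hw] at h
    revert h; decide
  obtain ⟨r2, hW2⟩ : ∃ r : F, W * W = algebraMap F H r := by
    obtain ⟨r, hr⟩ := (hker (w * w)).1 (by rw [map_mul, hw]; decide)
    exact ⟨r, by push_cast at hr; exact hr⟩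
  obtain ⟨s, hs⟩ : ∃ r : F, U * W * U * ((w⁻¹ : (↥O)ˣ) : O) = algebraMap F H r := by
    obtain ⟨r, hr⟩ := (hker (u * w * u * w⁻¹)).1 (by
      rw [map_mul, map_mul, map_mul, map_inv, hw, hu]; decide)
    exact ⟨r, by push_cast at hr; exact hr⟩
  have hVW : (((w⁻¹ : (↥O)ˣ) : O) : H) * W = 1 := by
    rw [hW, ← Subring.coe_mul]; simp
  obtain ⟨n, hn⟩ := hT.2.2 U
  obtain ⟨hτ0, hτ⟩ := trace_sq_eq_three_norm hn hU2 hU3 hU6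
  obtain ⟨η, hη⟩ := exists_unit_eq_norm hT hO u hn
  have hn0 : n ≠ 0 := by
    rintro rfl
    exact hτ0 (by simpa using hτ)
  have hrel : W * U = T U • W - U * W := conj_relation hT hn hn0 hτ0 hVW hs
  have hηpos : 0 < σ₀ (algebraMap (𝓞 F) F ↑η) := by
    have h1 : σ₀ (T U) ^ 2 = 3 * σ₀ n := by rw [← map_pow, hτ, map_mul, map_ofNat]
    have h2 : 0 < σ₀ (T U) ^ 2 := by
      have := (map_ne_zero σ₀).2 hτ0
      positivity
    rw [hη]; linarith
  obtain ⟨k, hk⟩ := eq_zpow_of_pos σ₀ hε hεfund η hηpos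
  have hk_odd : Odd k := by
    rw [← Int.not_even_iff_odd]
    rintro ⟨m, rfl⟩
    have hm : n = algebraMap (𝓞 F) F ↑(ε ^ m) ^ 2 := by
      rw [← hη, hk, zpow_add, Units.val_mul, map_mul, sq]
    have hm0 : algebraMap (𝓞 F) F ↑(ε ^ m) ≠ 0 := by
      intro h; rw [h] at hm; exact hn0 (by simpa using hm)
    apply h3 (T U / algebraMap (𝓞 F) F ↑(ε ^ m))
    rw [div_pow, hτ, hm]
    field_simp
  obtain ⟨m, rfl⟩ := hk_odd
  set E := algebraMap (𝓞 F) F ↑ε with hE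
  set g := algebraMap (𝓞 F) F ↑(ε ^ (-m)) with hg
  have hgn : g ^ 2 * n = E := by
    rw [hg, ← hη, hk, ← map_pow, ← map_mul, ← Units.val_pow_eq_pow_val, ← Units.val_mul]
    congr 2
    rw [← zpow_natCast, ← zpow_mul, ← zpow_add]
    convert zpow_one ε using 2
    push_cast; ring
  have hUO : U ∈ O := (u : O).2
  have hWO : W ∈ O := (w : O).2
  have fin : ∀ (x : H) (l : ℤ), x ∈ O →
      x * x = -(algebraMap (𝓞 F) F ↑(ε ^ (l + l))) • (1 : H) → x * U = T U • x - U * x →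
      ∃ t : F, 3 * E = t ^ 2 ∧
        ∃ q : QuaternionAlgebra.Basis H (-E) t (-1), q.i ∈ O ∧ q.j ∈ O := by
    intro x l hxO hxx hxU
    set h := algebraMap (𝓞 F) F ↑(ε ^ (-l)) with hh
    have hhl : h ^ 2 * algebraMap (𝓞 F) F ↑(ε ^ (l + l)) = 1 := by
      rw [hh, ← map_pow, ← map_mul, ← Units.val_pow_eq_pow_val, ← Units.val_mul,
        ← zpow_natCast, ← zpow_mul, ← zpow_add]
      have : -l * ((2 : ℕ) : ℤ) + (l + l) = 0 := by push_cast; ring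
      rw [this]; simp
    rw [Algebra.algebraMap_eq_smul_one] at hn
    refine ⟨g * T U, by rw [mul_pow, hτ, ← hgn]; ring, ⟨g • U, h • x, (g • U) * (h • x),
      ?_, ?_, rfl, ?_⟩, ?_, ?_⟩
    · rw [smul_mul_smul_comm, hn, ← hgn]; module
    · rw [smul_mul_smul_comm, hxx, smul_smul, ← hhl]; module
    · rw [smul_mul_smul_comm, smul_mul_smul_comm, hxU]; module
    · change g • U ∈ O
      rw [Algebra.smul_def]
      exact O.mul_mem (algebraMap_mem_order hO _) hUO
    · change h • x ∈ O
      rw [Algebra.smul_def]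
      exact O.mul_mem (algebraMap_mem_order hO _) hxO
  obtain ⟨N, hN⟩ := hT.2.2 W
  have hTW : T W = 0 := by
    refine coeff_eq_zero_of_scalar (b := -N) hW1 ((?_ : _ = W * W).trans hW2)
    rw [hN, Algebra.algebraMap_eq_smul_one]; module
  obtain ⟨ν, hν⟩ := exists_unit_eq_norm hT hO w hN
  rw [hTW, zero_smul, zero_sub, ← map_neg] at hN
  have hνpos : 0 < σ₀ (algebraMap (𝓞 F) F ↑ν) := by
    have := neg_of_sq_scalar hdef σ₀ hW1 hN
    rw [map_neg] at this
    rw [hν]; linarith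
  obtain ⟨l, hl⟩ := eq_zpow_of_pos σ₀ hε hεfund ν hνpos
  rw [Algebra.algebraMap_eq_smul_one] at hN hn
  rcases Int.even_or_odd' l with ⟨l, rfl | rfl⟩
  · refine fin W l hWO ?_ hrel
    rw [hN, ← hν, hl, two_mul]
  · refine fin (W * U) (l + m + 1) (O.mul_mem hWO hUO) ?_ ?_
    · have h1 : l + m + 1 + (l + m + 1) = (2 * l + 1) + (2 * m + 1) := by ring
      rw [h1, zpow_add, ← hl, ← hk, Units.val_mul, map_mul, hν, hη]
      have h2 : U * (W * U) = n • W := by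
        rw [hrel, mul_sub, mul_smul_comm, ← mul_assoc, hn, sub_mul, smul_mul_assoc,
          smul_mul_assoc, one_mul]
        abel
      rw [mul_assoc, h2, mul_smul_comm, hN, smul_smul]
      congr 1; ring
    · rw [← mul_assoc U W U]
      nth_rewrite 1 [hrel]
      rw [sub_mul, smul_mul_assoc]

end UnitsOfOrders

section BasisOrder

variable {F} {H : Type} [Ring H] [Algebra F H]

omit [NumberField F] in
lemma bijective_liftHom {a b c : F} (q : QuaternionAlgebra.Basis H a b c)
    (hfin : Module.finrank F H = 4) (hN : ∀ x : ℍ[F, a, b, c], (x * star x).re = 0 → x = 0) :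
    Function.Bijective q.liftHom := by
  have : Nontrivial H := Module.nontrivial_of_finrank_pos (R := F) (by omega)
  have : FiniteDimensional F H := Module.finite_of_finrank_pos (by omega)
  have hinj : Function.Injective q.liftHom := by
    rw [injective_iff_map_eq_zero]
    intro x hx
    apply hN
    have h1 : q.liftHom (x * star x) = 0 := by rw [map_mul, hx, zero_mul]
    rw [QuaternionAlgebra.mul_star_eq_coe, ← QuaternionAlgebra.coe_algebraMap,
      AlgHom.commutes] at h1
    exact (map_eq_zero_iff _ (algebraMap F H).injective).1 h1
  exact ⟨hinj, (LinearMap.injective_iff_surjective_of_finrank_eq_finrank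
    (f := q.liftHom.toLinearMap) (by rw [QuaternionAlgebra.finrank_eq_four, hfin])).1 hinj⟩

omit [NumberField F] in
lemma isUnit_of_bijective_liftHom {a b c : F} (q : QuaternionAlgebra.Basis H a b c)
    (hq : Function.Bijective q.liftHom)
    (hN : ∀ x : ℍ[F, a, b, c], (x * star x).re = 0 → x = 0) {x : H} (hx : x ≠ 0) : IsUnit x := by
  obtain ⟨z, rfl⟩ := hq.2 x
  have hz : (z * star z).re ≠ 0 := fun h => hx (by rw [hN z h, map_zero])
  obtain ⟨n, hn⟩ : ∃ n, n = (z * star z).re := ⟨_, rfl⟩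
  have h1 : z * star z = algebraMap F _ n := by
    rw [hn, QuaternionAlgebra.coe_algebraMap]; exact QuaternionAlgebra.mul_star_eq_coe z
  have h2 : star z * z = algebraMap F _ n := by
    rw [← h1]; exact (star_comm_self' z)
  rw [← hn] at hz
  have : IsUnit z := by
    refine ⟨⟨z, n⁻¹ • star z, ?_, ?_⟩, rfl⟩
    · rw [mul_smul_comm, h1, Algebra.algebraMap_eq_smul_one, smul_smul, inv_mul_cancel₀ hz,
        one_smul]
    · rw [smul_mul_assoc, h2, Algebra.algebraMap_eq_smul_one, smul_smul, inv_mul_cancel₀ hz,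
        one_smul]
  exact this.map q.liftHom

omit [NumberField F] in
/-- Any two quaternion bases of the same type are conjugate. -/
lemma exists_conj_basis {e t : F} (q q' : QuaternionAlgebra.Basis H (-e) t (-1))
    (hu : ∀ x : H, x ≠ 0 → IsUnit x) (hi : ∀ (p : QuaternionAlgebra.Basis H (-e) t (-1)),
      (2 : F) • p.i ≠ t • 1) :
    ∃ x : Hˣ, ∀ z, x * q.liftHom z = q'.liftHom z * x := by
  have h2 : ∃ x : Hˣ, x * q.i = q'.i * x := by
    by_cases h : q'.i + q.i - t • 1 = 0
    · have hji := q.j_mul_i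
      rw [← q.i_mul_j] at hji
      have hi' : q'.i = t • 1 - q.i := by rw [← sub_eq_zero, ← h]; abel
      refine ⟨⟨q.j, -q.j, by simp, by simp⟩, ?_⟩
      change q.j * q.i = q'.i * q.j
      rw [hi', hji, sub_mul, smul_mul_assoc, one_mul]
    · obtain ⟨x, hx⟩ := hu _ h
      refine ⟨x, ?_⟩
      rw [hx]
      simp only [sub_mul, add_mul, mul_sub, mul_add, q.i_mul_i, q'.i_mul_i, smul_mul_assoc,
        mul_smul_comm, one_mul, mul_one]
      abel
  obtain ⟨x, hx⟩ := h2
  have hxi : q'.i = x * q.i * (x⁻¹ : Hˣ) := by rw [hx, mul_assoc, Units.mul_inv, mul_one]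
  set w : H := x * q.j * (x⁻¹ : Hˣ) with hw
  have hww : w * w = -1 := by
    have : w * w = x * (q.j * q.j) * (x⁻¹ : Hˣ) := by
      rw [hw]; simp only [mul_assoc, Units.inv_mul_cancel_left]
    rw [this, q.j_mul_j]; simp
  have hwi : w * q'.i = t • w - q'.i * w := by
    have h1 : w * q'.i = x * (q.j * q.i) * (x⁻¹ : Hˣ) := by
      rw [hw, hxi]; simp only [mul_assoc, Units.inv_mul_cancel_left]
    have h2 : q'.i * w = x * (q.i * q.j) * (x⁻¹ : Hˣ) := by
      rw [hw, hxi]; simp only [mul_assoc, Units.inv_mul_cancel_left]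
    rw [h1, h2, q.j_mul_i, q.i_mul_j, hw, mul_sub, sub_mul, mul_smul_comm, smul_mul_assoc]
  have hji : q'.j * q'.i = t • q'.j - q'.i * q'.j := by rw [q'.j_mul_i, q'.i_mul_j]
  have hjj : q'.j * q'.j = -1 := by rw [q'.j_mul_j]; simp
  have hxj : (x : H) * q.j = w * x := by rw [hw, mul_assoc, Units.inv_mul, mul_one]
  clear_value w
  have h3 : ∃ y : Hˣ, y * q'.i = q'.i * y ∧ y * w = q'.j * y := by
    by_cases h : 1 - q'.j * w = 0
    · have hwj : w = -q'.j := by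
        have h4 : q'.j * w = 1 := (sub_eq_zero.1 h).symm
        have := congrArg (q'.j * ·) h4
        simp only [← mul_assoc, hjj, mul_one, neg_mul, one_mul] at this
        rw [← this, neg_neg]
      obtain ⟨y, hy⟩ := hu ((2 : F) • q'.i - t • 1) (sub_ne_zero.2 (hi q'))
      refine ⟨y, ?_, ?_⟩
      · rw [hy]; simp only [sub_mul, mul_sub, smul_mul_assoc, mul_smul_comm, one_mul, mul_one]
      · rw [hy, hwj]
        simp only [sub_mul, mul_sub, smul_mul_assoc, mul_smul_comm, one_mul, mul_one, hji, mul_neg]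
        module
    · obtain ⟨y, hy⟩ := hu _ h
      refine ⟨y, ?_, ?_⟩
      · rw [hy, sub_mul, mul_sub, one_mul, mul_one, mul_assoc, hwi, mul_sub, mul_smul_comm,
          ← mul_assoc, hji, sub_mul, smul_mul_assoc, ← mul_assoc]
        abel
      · rw [hy, sub_mul, mul_sub, one_mul, mul_one, mul_assoc, hww, ← mul_assoc, hjj]
        simp; abel
  obtain ⟨y, hy1, hy2⟩ := h3
  have hyi : ((y * x : Hˣ) : H) * q.i = q'.i * (y * x : Hˣ) := by
    rw [Units.val_mul, mul_assoc, hx, ← mul_assoc, hy1, mul_assoc]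
  have hyj : ((y * x : Hˣ) : H) * q.j = q'.j * (y * x : Hˣ) := by
    rw [Units.val_mul, mul_assoc, hxj, ← mul_assoc, hy2, mul_assoc]
  have hyk : ((y * x : Hˣ) : H) * q.k = q'.k * (y * x : Hˣ) := by
    rw [← q.i_mul_j, ← q'.i_mul_j, ← mul_assoc, hyi, mul_assoc, hyj, mul_assoc]
  refine ⟨y * x, fun z => ?_⟩
  simp only [QuaternionAlgebra.Basis.liftHom_apply, QuaternionAlgebra.Basis.lift, mul_add, add_mul,
    mul_smul_comm, smul_mul_assoc, hyi, hyj, hyk, Algebra.commutes]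

variable {e t : F}

/-- The subring of a quaternion algebra of elements with integral coordinates. -/
def integralSubring (he : IsIntegral ℤ e) (ht : IsIntegral ℤ t) : Subring ℍ[F, -e, t, -1] where
  carrier := {x | IsIntegral ℤ x.re ∧ IsIntegral ℤ x.imI ∧ IsIntegral ℤ x.imJ ∧ IsIntegral ℤ x.imK}
  mul_mem' := by
    rintro x y ⟨h1, h2, h3, h4⟩ ⟨g1, g2, g3, g4⟩
    change x.re ∈ integralClosure ℤ F at h1
    change x.imI ∈ integralClosure ℤ F at h2
    change x.imJ ∈ integralClosure ℤ F at h3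
    change x.imK ∈ integralClosure ℤ F at h4
    change y.re ∈ integralClosure ℤ F at g1
    change y.imI ∈ integralClosure ℤ F at g2
    change y.imJ ∈ integralClosure ℤ F at g3
    change y.imK ∈ integralClosure ℤ F at g4
    change e ∈ integralClosure ℤ F at he
    change t ∈ integralClosure ℤ F at ht
    refine ⟨?_, ?_, ?_, ?_⟩
    · change (x * y).re ∈ integralClosure ℤ F
      rw [QuaternionAlgebra.re_mul]
      repeat first
        | assumption | apply add_mem | apply sub_mem | apply mul_mem | apply neg_mem | apply one_mem
    · change (x * y).imI ∈ integralClosure ℤ F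
      rw [QuaternionAlgebra.imI_mul]
      repeat first
        | assumption | apply add_mem | apply sub_mem | apply mul_mem | apply neg_mem | apply one_mem
    · change (x * y).imJ ∈ integralClosure ℤ F
      rw [QuaternionAlgebra.imJ_mul]
      repeat first
        | assumption | apply add_mem | apply sub_mem | apply mul_mem | apply neg_mem | apply one_mem
    · change (x * y).imK ∈ integralClosure ℤ F
      rw [QuaternionAlgebra.imK_mul]
      repeat first
        | assumption | apply add_mem | apply sub_mem | apply mul_mem | apply neg_mem | apply one_mem
  one_mem' := by
    simp [isIntegral_one, isIntegral_zero]
  add_mem' := by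
    rintro x y ⟨h1, h2, h3, h4⟩ ⟨g1, g2, g3, g4⟩
    exact ⟨h1.add g1, h2.add g2, h3.add g3, h4.add g4⟩
  zero_mem' := by
    simp [isIntegral_zero]
  neg_mem' := by
    rintro x ⟨h1, h2, h3, h4⟩
    exact ⟨h1.neg, h2.neg, h3.neg, h4.neg⟩

end BasisOrder

section BasisOrderMaximal

variable {F} {H : Type} [Ring H] [Algebra F H] {e t : F}

omit [NumberField F] in
lemma re_mul_star (z : ℍ[F, -e, t, -1]) : (z * star z).re =
    z.re ^ 2 + t * z.re * z.imI + e * z.imI ^ 2 +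
      (z.imJ ^ 2 + t * z.imJ * z.imK + e * z.imK ^ 2) := by
  simp only [QuaternionAlgebra.re_mul, QuaternionAlgebra.re_star, QuaternionAlgebra.imI_star,
    QuaternionAlgebra.imJ_star, QuaternionAlgebra.imK_star]
  ring

omit [NumberField F] in
lemma four_mul_form (ht : 3 * e = t ^ 2) (a b : F) :
    4 * (a ^ 2 + t * a * b + e * b ^ 2) = (2 * a + t * b) ^ 2 + e * b ^ 2 := by
  linear_combination b ^ 2 * ht

omit [NumberField F] in
lemma form_nonneg (ht : 3 * e = t ^ 2) (σ : F →+* ℝ) (a b : F) :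
    0 ≤ σ (a ^ 2 + t * a * b + e * b ^ 2) := by
  have h1 := congrArg σ (four_mul_form ht a b)
  have h2 := congrArg σ ht
  simp only [map_mul, map_pow, map_add, map_ofNat] at h1 h2 ⊢
  nlinarith [sq_nonneg (2 * σ a + σ t * σ b), sq_nonneg (σ t * σ b), sq_nonneg (σ b),
    sq_nonneg (σ t), mul_nonneg (sq_nonneg (σ b)) (sq_nonneg (σ t))]

omit [NumberField F] in
lemma form_eq_zero (ht : 3 * e = t ^ 2) (he : e ≠ 0) (σ : F →+* ℝ) {a b : F}
    (h : σ (a ^ 2 + t * a * b + e * b ^ 2) = 0) : a = 0 ∧ b = 0 := by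
  have h1 := congrArg σ (four_mul_form ht a b)
  have h2 := congrArg σ ht
  have h0 : (2 * a + t * b) ^ 2 + e * b ^ 2 = 0 := by
    rw [← four_mul_form ht, (map_eq_zero σ).1 h, mul_zero]
  have ht0 : t ≠ 0 := by
    rintro rfl
    apply he
    have := congrArg σ ht
    simp only [map_mul, map_ofNat, map_pow, map_zero] at this
    rw [← map_eq_zero σ]; nlinarith
  have h3 : 3 * σ (2 * a + t * b) ^ 2 + σ (t * b) ^ 2 = 0 := by
    rw [← map_pow, ← map_pow, ← map_ofNat σ, ← map_mul, ← map_add, map_eq_zero]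
    linear_combination 3 * h0 - b ^ 2 * ht
  have h4 : σ (t * b) = 0 := by nlinarith [sq_nonneg (σ (2 * a + t * b)), sq_nonneg (σ (t * b))]
  have h5 : σ (2 * a + t * b) = 0 := by
    nlinarith [sq_nonneg (σ (2 * a + t * b)), sq_nonneg (σ (t * b))]
  have hb : b = 0 := (mul_eq_zero.1 ((map_eq_zero σ).1 h4)).resolve_left ht0
  have h6 := (map_eq_zero σ).1 h5
  rw [hb, mul_zero, add_zero] at h6
  have : σ 2 * σ a = 0 := by rw [← map_mul, h6, map_zero]
  rw [map_ofNat] at this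
  exact ⟨(map_eq_zero σ).1 (by linarith), hb⟩

omit [NumberField F] in
lemma eq_zero_of_re_mul_star (ht : 3 * e = t ^ 2) (he : e ≠ 0) (σ : F →+* ℝ)
    (z : ℍ[F, -e, t, -1]) (hz : (z * star z).re = 0) : z = 0 := by
  rw [re_mul_star] at hz
  have h := congrArg σ hz
  rw [map_add, map_zero] at h
  have h1 := form_nonneg ht σ z.re z.imI
  have h2 := form_nonneg ht σ z.imJ z.imK
  obtain ⟨h3, h4⟩ := form_eq_zero ht he σ
    (by linarith : σ (z.re ^ 2 + t * z.re * z.imI + e * z.imI ^ 2) = 0)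
  obtain ⟨h5, h6⟩ := form_eq_zero ht he σ
    (by linarith : σ (z.imJ ^ 2 + t * z.imJ * z.imK + e * z.imK ^ 2) = 0)
  ext <;> assumption

/-- The order spanned over the integers by a quaternion basis. -/
def basisOrder (he : IsIntegral ℤ e) (ht : IsIntegral ℤ t)
    (q : QuaternionAlgebra.Basis H (-e) t (-1)) : Subring H :=
  (integralSubring he ht).map (q.liftHom : ℍ[F, -e, t, -1] →+* H)

omit [NumberField F] in
lemma mem_basisOrder {he : IsIntegral ℤ e} {ht : IsIntegral ℤ t}
    {q : QuaternionAlgebra.Basis H (-e) t (-1)} {x : H} :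
    x ∈ basisOrder he ht q ↔ ∃ z : ℍ[F, -e, t, -1], (IsIntegral ℤ z.re ∧ IsIntegral ℤ z.imI ∧
      IsIntegral ℤ z.imJ ∧ IsIntegral ℤ z.imK) ∧ q.liftHom z = x := Iff.rfl

omit [NumberField F] in
lemma liftHom_mem_basisOrder {he : IsIntegral ℤ e} {ht : IsIntegral ℤ t}
    {q : QuaternionAlgebra.Basis H (-e) t (-1)} {z : ℍ[F, -e, t, -1]}
    (h1 : IsIntegral ℤ z.re) (h2 : IsIntegral ℤ z.imI) (h3 : IsIntegral ℤ z.imJ)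
    (h4 : IsIntegral ℤ z.imK) : q.liftHom z ∈ basisOrder he ht q :=
  mem_basisOrder.2 ⟨z, ⟨h1, h2, h3, h4⟩, rfl⟩

omit [NumberField F] in
lemma i_mem_basisOrder (he : IsIntegral ℤ e) (ht : IsIntegral ℤ t)
    (q : QuaternionAlgebra.Basis H (-e) t (-1)) : q.i ∈ basisOrder he ht q :=
  mem_basisOrder.2 ⟨⟨0, 1, 0, 0⟩,
    ⟨isIntegral_zero, isIntegral_one, isIntegral_zero, isIntegral_zero⟩, by
      simp [QuaternionAlgebra.Basis.liftHom_apply, QuaternionAlgebra.Basis.lift]⟩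

omit [NumberField F] in
lemma j_mem_basisOrder (he : IsIntegral ℤ e) (ht : IsIntegral ℤ t)
    (q : QuaternionAlgebra.Basis H (-e) t (-1)) : q.j ∈ basisOrder he ht q :=
  mem_basisOrder.2 ⟨⟨0, 0, 1, 0⟩,
    ⟨isIntegral_zero, isIntegral_zero, isIntegral_one, isIntegral_zero⟩, by
      simp [QuaternionAlgebra.Basis.liftHom_apply, QuaternionAlgebra.Basis.lift]⟩

omit [NumberField F] in
lemma basisOrder_le {he : IsIntegral ℤ e} {ht : IsIntegral ℤ t}
    {q : QuaternionAlgebra.Basis H (-e) t (-1)} {O : Subring H} (hO : scalarSet F H ⊆ O)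
    (hi : q.i ∈ O) (hj : q.j ∈ O) : basisOrder he ht q ≤ O := by
  intro x hx
  obtain ⟨z, ⟨h1, h2, h3, h4⟩, rfl⟩ := mem_basisOrder.1 hx
  have hs : ∀ r : F, IsIntegral ℤ r → algebraMap F H r ∈ O := fun r hr => hO ⟨⟨r, hr⟩, rfl⟩
  simp only [QuaternionAlgebra.Basis.liftHom_apply, QuaternionAlgebra.Basis.lift, ← q.i_mul_j,
    Algebra.smul_def]
  exact add_mem (add_mem (add_mem (hs _ h1) (mul_mem (hs _ h2) hi)) (mul_mem (hs _ h3) hj))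
    (mul_mem (hs _ h4) (mul_mem hi hj))

lemma isOrder_basisOrder (he : IsIntegral ℤ e) (ht : IsIntegral ℤ t)
    (q : QuaternionAlgebra.Basis H (-e) t (-1)) (hq : Function.Surjective q.liftHom) :
    IsOrder F (basisOrder he ht q) := by
  refine ⟨?_, ?_, ?_⟩
  · rintro _ ⟨r, rfl⟩
    refine mem_basisOrder.2 ⟨⟨r, 0, 0, 0⟩,
      ⟨r.2, isIntegral_zero, isIntegral_zero, isIntegral_zero⟩, ?_⟩
    simp [QuaternionAlgebra.Basis.liftHom_apply, QuaternionAlgebra.Basis.lift]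
  · let f : (Fin 4 → 𝓞 F) →+ H :=
      { toFun := fun v => q.liftHom ⟨v 0, v 1, v 2, v 3⟩
        map_zero' := by
          rw [← map_zero q.liftHom]; rfl
        map_add' := by
          intro v w
          rw [← map_add q.liftHom]; rfl }
    have hf : (basisOrder he ht q).toAddSubgroup = f.range := by
      ext x
      constructor
      · intro hx
        obtain ⟨z, ⟨h1, h2, h3, h4⟩, rfl⟩ := mem_basisOrder.1 hx
        exact ⟨![⟨z.re, h1⟩, ⟨z.imI, h2⟩, ⟨z.imJ, h3⟩, ⟨z.imK, h4⟩], rfl⟩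
      · rintro ⟨v, rfl⟩
        exact liftHom_mem_basisOrder (v 0).2 (v 1).2 (v 2).2 (v 3).2
    have h1 : (⊤ : Submodule ℤ (Fin 4 → 𝓞 F)).FG := Module.Finite.fg_top
    have h2 : (LinearMap.range f.toIntLinearMap).FG := by
      rw [LinearMap.range_eq_map]; exact h1.map _
    rw [Submodule.fg_iff_addSubgroup_fg] at h2
    rw [hf]
    exact h2
  · rw [eq_top_iff]
    intro x _
    obtain ⟨z, rfl⟩ := hq x
    have h1 : (1 : H) ∈ basisOrder he ht q := one_mem _
    have hi := i_mem_basisOrder he ht q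
    have hj := j_mem_basisOrder he ht q
    have hk := mul_mem hi hj
    simp only [QuaternionAlgebra.Basis.liftHom_apply, QuaternionAlgebra.Basis.lift, ← q.i_mul_j,
      Algebra.algebraMap_eq_smul_one]
    exact add_mem (add_mem (add_mem (Submodule.smul_mem _ _ (Submodule.subset_span h1))
      (Submodule.smul_mem _ _ (Submodule.subset_span hi)))
      (Submodule.smul_mem _ _ (Submodule.subset_span hj)))
      (Submodule.smul_mem _ _ (Submodule.subset_span hk))

lemma isMaximalOrder_basisOrder (he : IsIntegral ℤ e) (ht : IsIntegral ℤ t)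
    (he' : IsIntegral ℤ e⁻¹) (he0 : e ≠ 0) (h3e : 3 * e = t ^ 2)
    (q : QuaternionAlgebra.Basis H (-e) t (-1)) (hq : Function.Bijective q.liftHom) :
    IsMaximalOrder F (basisOrder he ht q) := by
  refine ⟨isOrder_basisOrder he ht q hq.2, fun O hO hle => le_antisymm ?_ hle⟩
  have : Nontrivial H := hq.1.nontrivial
  obtain ⟨T, hT, hTe⟩ := exists_isRedTrace (AlgEquiv.ofBijective q.liftHom hq).symm
  have hTz : ∀ z : ℍ[F, -e, t, -1], T (q.liftHom z) = 2 * z.re + t * z.imI := by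
    intro z
    rw [hTe]
    have : (AlgEquiv.ofBijective q.liftHom hq).symm (q.liftHom z) = z :=
      (AlgEquiv.ofBijective q.liftHom hq).symm_apply_apply z
    rw [this]
  have hinteg : ∀ z, q.liftHom z ∈ O → IsIntegral ℤ (2 * z.re + t * z.imI) := by
    intro z hz
    obtain ⟨n, hn⟩ := hT.2.2 (q.liftHom z)
    rw [← hTz]
    exact (isIntegral_of_redTrace hT hn (isIntegral_of_mem_order hO hz)).1
  have hmem : ∀ w : ℍ[F, -e, t, -1], (IsIntegral ℤ w.re ∧ IsIntegral ℤ w.imI ∧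
      IsIntegral ℤ w.imJ ∧ IsIntegral ℤ w.imK) → q.liftHom w ∈ O :=
    fun w hw => hle (mem_basisOrder.2 ⟨w, hw, rfl⟩)
  intro x hx
  obtain ⟨z, rfl⟩ := hq.2 x
  have mulint : ∀ w : ℍ[F, -e, t, -1], (IsIntegral ℤ w.re ∧ IsIntegral ℤ w.imI ∧
      IsIntegral ℤ w.imJ ∧ IsIntegral ℤ w.imK) →
      IsIntegral ℤ (2 * (z * w).re + t * (z * w).imI) := fun w hw => by
    apply hinteg
    rw [map_mul]
    exact mul_mem hx (hmem w hw)
  have s1 := hinteg z hx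
  have s2 := mulint ⟨0, 1, 0, 0⟩ ⟨isIntegral_zero, isIntegral_one, isIntegral_zero, isIntegral_zero⟩
  have s3 := mulint ⟨0, 0, 1, 0⟩ ⟨isIntegral_zero, isIntegral_zero, isIntegral_one, isIntegral_zero⟩
  have s4 := mulint ⟨0, 0, 0, 1⟩ ⟨isIntegral_zero, isIntegral_zero, isIntegral_zero, isIntegral_one⟩
  have i2 : IsIntegral ℤ (2 : F) := by
    rw [← one_add_one_eq_two]; exact isIntegral_one.add isIntegral_one
  simp only [QuaternionAlgebra.re_mul, QuaternionAlgebra.imI_mul, mul_zero, mul_one, zero_add,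
    add_zero, sub_zero, zero_sub, mul_neg, neg_mul, neg_neg] at s2 s3 s4
  have congr : ∀ {x y : F}, IsIntegral ℤ x → x = y → IsIntegral ℤ y := fun h1 h2 => h2 ▸ h1
  have hf : e * e⁻¹ = 1 := mul_inv_cancel₀ he0
  apply liftHom_mem_basisOrder
  · refine congr (((ht.mul s2).mul he').sub s1) ?_
    linear_combination (3 * z.re + t * z.imI) * hf - e⁻¹ * (z.re + t * z.imI) * h3e
  · refine congr (((ht.mul s1).sub (i2.mul s2)).mul he') ?_
    linear_combination z.imI * hf + z.imI * e⁻¹ * h3e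
  · refine congr (((ht.mul s4).mul he').sub (i2.mul s3)) ?_
    linear_combination -(2 * t * z.imK + 3 * z.imJ) * hf + z.imJ * e⁻¹ * h3e
  · refine congr (((ht.mul s3).sub (i2.mul s4)).mul he') ?_
    linear_combination z.imK * hf + z.imK * e⁻¹ * h3e

end BasisOrderMaximal

section BasisOrderUnits

variable {F} {e t : F}

omit [NumberField F] in
/-- Integral solutions of `a ^ 2 + t * a * b + e * b ^ 2 = 1`. -/
lemma form_eq_one_cases (h3e : 3 * e = t ^ 2) (he0 : e ≠ 0) (σ₀ σ₁ : F →+* ℝ)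
    (hinteg : ∀ x : F, IsIntegral ℤ x → |σ₀ x| ≤ 2 → |σ₁ x| ≤ 2 →
      x = 0 ∨ x = 1 ∨ x = -1 ∨ x = 2 ∨ x = -2)
    (h3 : ∀ x : F, x ^ 2 ≠ 3) (ht : IsIntegral ℤ t) {a b : F} (ha : IsIntegral ℤ a)
    (hb : IsIntegral ℤ b) (hab : a ^ 2 + t * a * b + e * b ^ 2 = 1) :
    ∃ r : F, (a = r ∧ b = 0) ∨ (a = -(r * e) ∧ b = r * t) ∨
      (a = -(2 * r * e ^ 2) ∧ b = r * t * e) := by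
  have h20 : (2 : F) ≠ 0 := by
    intro h
    have := congrArg σ₀ h
    rw [map_ofNat, map_zero] at this
    norm_num at this
  have ht0 : t ≠ 0 := by
    rintro rfl
    apply he0
    have := congrArg σ₀ h3e
    simp only [map_mul, map_ofNat, map_pow, map_zero] at this
    rw [← map_eq_zero σ₀]; nlinarith
  have h4 := four_mul_form h3e a b
  rw [hab, mul_one] at h4
  have habs : ∀ σ : F →+* ℝ, |σ (2 * a + t * b)| ≤ 2 := by
    intro σ
    have h5 := congrArg σ h4
    have h6 := congrArg σ h3e
    rw [map_add, map_mul, map_pow, map_pow, map_ofNat] at h5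
    rw [map_mul, map_ofNat, map_pow] at h6
    have h7 : 0 ≤ σ e := by nlinarith [sq_nonneg (σ t)]
    rw [← sq_le_sq₀ (abs_nonneg _) (by norm_num), sq_abs]
    nlinarith [mul_nonneg h7 (sq_nonneg (σ b))]
  have i2 : IsIntegral ℤ (2 : F) := by
    rw [← one_add_one_eq_two]; exact isIntegral_one.add isIntegral_one
  have hcase := hinteg _ ((i2.mul ha).add (ht.mul hb)) (habs σ₀) (habs σ₁)
  have htwo : ∀ {s : F}, 2 * a + t * b = s → s ^ 2 = 4 → b = 0 := by
    intro s hs hs4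
    rw [hs, hs4] at h4
    have : e * b ^ 2 = 0 := by linear_combination -h4
    simpa [he0] using this
  have hone : ∀ {s : F}, 2 * a + t * b = s → s ^ 2 = 1 →
      t * b = 3 * s ∨ t * b = -(3 * s) := by
    intro s hs hs1
    rw [hs, hs1] at h4
    apply sq_eq_sq_iff_eq_or_eq_neg.1
    linear_combination -b ^ 2 * h3e - 3 * h4 - 9 * hs1
  have hodd : ∀ {s : F}, 2 * a + t * b = s → s ^ 2 = 1 → ∃ r : F,
      (a = -(r * e) ∧ b = r * t) ∨ (a = -(2 * r * e ^ 2) ∧ b = r * t * e) := by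
    intro s hs hs1
    rcases hone hs hs1 with h | h
    · have h5 : a = -s := mul_left_cancel₀ h20 (by linear_combination hs - h)
      have h6 : b * e = s * t := mul_left_cancel₀ ht0 (by linear_combination e * h + s * h3e)
      refine ⟨s * e⁻¹, Or.inl ⟨?_, ?_⟩⟩
      · rw [h5, inv_mul_cancel_right₀ he0]
      · field_simp
        exact h6
    · have h5 : a = 2 * s := mul_left_cancel₀ h20 (by linear_combination hs - h)
      have h6 : b * e = -(s * t) := mul_left_cancel₀ ht0 (by linear_combination e * h - s * h3e)
      refine ⟨-s * (e ^ 2)⁻¹, Or.inr ⟨?_, ?_⟩⟩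
      · rw [h5]
        field_simp
      · field_simp
        exact h6
  rcases hcase with h | h | h | h | h
  · exfalso
    rw [h] at h4
    apply h3 (t * b / 2)
    field_simp
    linear_combination -b ^ 2 * h3e - 3 * h4
  · obtain ⟨r, hr⟩ := hodd h (by norm_num)
    exact ⟨r, Or.inr hr⟩
  · obtain ⟨r, hr⟩ := hodd h (by norm_num)
    exact ⟨r, Or.inr hr⟩
  · exact ⟨a, Or.inl ⟨rfl, htwo h (by norm_num)⟩⟩
  · exact ⟨a, Or.inl ⟨rfl, htwo h (by norm_num)⟩⟩

variable {H : Type} [Ring H] [Algebra F H]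

omit [NumberField F] in
lemma eq_smul_pow_of_form_eq_one (h3e : 3 * e = t ^ 2) (he0 : e ≠ 0) (σ₀ σ₁ : F →+* ℝ)
    (hinteg : ∀ x : F, IsIntegral ℤ x → |σ₀ x| ≤ 2 → |σ₁ x| ≤ 2 →
      x = 0 ∨ x = 1 ∨ x = -1 ∨ x = 2 ∨ x = -2)
    (h3 : ∀ x : F, x ^ 2 ≠ 3) (ht : IsIntegral ℤ t)
    (q : QuaternionAlgebra.Basis H (-e) t (-1)) {a b : F} (ha : IsIntegral ℤ a)
    (hb : IsIntegral ℤ b) (hab : a ^ 2 + t * a * b + e * b ^ 2 = 1) :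
    ∃ (r : F) (m : ℕ), algebraMap F H a + b • q.i = r • q.i ^ m := by
  have hi := q.i_mul_i
  obtain ⟨r, ⟨rfl, rfl⟩ | ⟨rfl, rfl⟩ | ⟨rfl, rfl⟩⟩ :=
    form_eq_one_cases h3e he0 σ₀ σ₁ hinteg h3 ht ha hb hab
  · exact ⟨a, 0, by rw [pow_zero, zero_smul, add_zero, Algebra.algebraMap_eq_smul_one]⟩
  · refine ⟨r, 2, ?_⟩
    rw [pow_two, hi, Algebra.algebraMap_eq_smul_one]
    module
  · refine ⟨r, 4, ?_⟩
    rw [show q.i ^ 4 = (q.i * q.i) * (q.i * q.i) by noncomm_ring, hi,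
      Algebra.algebraMap_eq_smul_one]
    simp only [add_mul, mul_add, smul_mul_assoc, mul_smul_comm, one_mul, mul_one, hi]
    linear_combination (norm := module) (-(r * e)) • h3e • (1 : H) + (r * t) • h3e • q.i

omit [NumberField F] in
lemma liftHom_eq_smul_of_norm_eq_one (h3e : 3 * e = t ^ 2) (he0 : e ≠ 0) (σ₀ σ₁ : F →+* ℝ)
    (hinteg : ∀ x : F, IsIntegral ℤ x → |σ₀ x| ≤ 2 → |σ₁ x| ≤ 2 →
      x = 0 ∨ x = 1 ∨ x = -1 ∨ x = 2 ∨ x = -2)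
    (h3 : ∀ x : F, x ^ 2 ≠ 3) (he : IsIntegral ℤ e) (ht : IsIntegral ℤ t)
    (q : QuaternionAlgebra.Basis H (-e) t (-1)) {z : ℍ[F, -e, t, -1]}
    (hz : z ∈ integralSubring he ht) (hn : (z * star z).re = 1) :
    ∃ (r : F) (m : ℕ), q.liftHom z = r • q.i ^ m ∨ q.liftHom z = r • (q.i ^ m * q.j) := by
  obtain ⟨z1, z2, z3, z4⟩ := hz
  rw [re_mul_star] at hn
  have hI : IsIntegral ℤ (z.re ^ 2 + t * z.re * z.imI + e * z.imI ^ 2) :=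
    ((z1.pow 2).add ((ht.mul z1).mul z2)).add (he.mul (z2.pow 2))
  have hle : ∀ σ : F →+* ℝ, |σ (z.re ^ 2 + t * z.re * z.imI + e * z.imI ^ 2)| ≤ 1 := by
    intro σ
    have h1 := congrArg σ hn
    rw [map_add, map_one] at h1
    rw [abs_of_nonneg (form_nonneg h3e σ _ _)]
    linarith [form_nonneg h3e σ z.imJ z.imK]
  have h0 := form_nonneg h3e σ₀ z.re z.imI
  have h1 := hle σ₀
  have hdich : z.re ^ 2 + t * z.re * z.imI + e * z.imI ^ 2 = 0 ∨
      z.re ^ 2 + t * z.re * z.imI + e * z.imI ^ 2 = 1 := by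
    rcases hinteg _ hI ((hle σ₀).trans one_le_two) ((hle σ₁).trans one_le_two) with h | h | h | h | h
    · exact Or.inl h
    · exact Or.inr h
    all_goals
      exfalso
      rw [h] at h0 h1
      simp only [map_neg, map_one, map_ofNat] at h0 h1
      revert h0 h1
      norm_num
  simp only [QuaternionAlgebra.Basis.liftHom_apply, QuaternionAlgebra.Basis.lift]
  rcases hdich with h | h
  · obtain ⟨hz1, hz2⟩ := form_eq_zero h3e he0 σ₀ (by rw [h, map_zero])
    rw [h, zero_add] at hn
    obtain ⟨r, m, hr⟩ := eq_smul_pow_of_form_eq_one h3e he0 σ₀ σ₁ hinteg h3 ht q z3 z4 hn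
    refine ⟨r, m, Or.inr ?_⟩
    rw [← smul_mul_assoc, ← hr, hz1, hz2, add_mul, ← Algebra.smul_def, smul_mul_assoc, q.i_mul_j]
    simp
  · rw [h, add_eq_left] at hn
    obtain ⟨hz1, hz2⟩ := form_eq_zero h3e he0 σ₀ (by rw [hn, map_zero])
    obtain ⟨r, m, hr⟩ := eq_smul_pow_of_form_eq_one h3e he0 σ₀ σ₁ hinteg h3 ht q z1 z2 h
    exact ⟨r, m, Or.inl (by rw [← hr, hz1, hz2]; simp)⟩

omit [NumberField F] in
lemma liftHom_eq_smul_of_norm_eq_zpow {ε : (𝓞 F)ˣ}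
    (h3e : 3 * algebraMap (𝓞 F) F ε = t ^ 2) (σ₀ σ₁ : F →+* ℝ)
    (hinteg : ∀ x : F, IsIntegral ℤ x → |σ₀ x| ≤ 2 → |σ₁ x| ≤ 2 →
      x = 0 ∨ x = 1 ∨ x = -1 ∨ x = 2 ∨ x = -2)
    (h3 : ∀ x : F, x ^ 2 ≠ 3) (he : IsIntegral ℤ (algebraMap (𝓞 F) F ε)) (ht : IsIntegral ℤ t)
    (q : QuaternionAlgebra.Basis H (-algebraMap (𝓞 F) F ε) t (-1))
    {z : ℍ[F, -algebraMap (𝓞 F) F ε, t, -1]}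
    (hz : z ∈ integralSubring he ht) (k : ℤ)
    (hn : (z * star z).re = algebraMap (𝓞 F) F (ε ^ k : (𝓞 F)ˣ)) :
    ∃ (r : F) (m : ℕ), q.liftHom z = r • q.i ^ m ∨ q.liftHom z = r • (q.i ^ m * q.j) := by
  have he0 : algebraMap (𝓞 F) F ε ≠ 0 := by
    simp
  have heven : ∀ (z : ℍ[F, -algebraMap (𝓞 F) F ε, t, -1]) (l : ℤ), z ∈ integralSubring he ht →
      (z * star z).re = algebraMap (𝓞 F) F (ε ^ (l + l) : (𝓞 F)ˣ) →
      ∃ (r : F) (m : ℕ), q.liftHom z = r • q.i ^ m ∨ q.liftHom z = r • (q.i ^ m * q.j) := by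
    intro z l hz hn
    set η : F := algebraMap (𝓞 F) F (ε ^ l : (𝓞 F)ˣ) with hη
    set η' : F := algebraMap (𝓞 F) F (ε ^ (-l) : (𝓞 F)ˣ) with hη'
    have hηη : η * η' = 1 := by
      rw [hη, hη', ← map_mul, ← Units.val_mul, ← zpow_add]; simp
    have hη'i : IsIntegral ℤ η' := RingOfIntegers.isIntegral_coe _
    have hn' : (z * star z).re = η * η := by
      rw [hn, hη, ← map_mul, ← Units.val_mul, ← zpow_add]
    have hz' : η' • z ∈ integralSubring he ht :=
      ⟨hη'i.mul hz.1, hη'i.mul hz.2.1, hη'i.mul hz.2.2.1, hη'i.mul hz.2.2.2⟩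
    have hn1 : ((η' • z) * star (η' • z)).re = 1 := by
      rw [re_mul_star] at hn' ⊢
      simp only [QuaternionAlgebra.re_smul, QuaternionAlgebra.imI_smul,
        QuaternionAlgebra.imJ_smul, QuaternionAlgebra.imK_smul, smul_eq_mul]
      linear_combination η' ^ 2 * hn' + (η * η' + 1) * hηη
    obtain ⟨r, m, h⟩ := liftHom_eq_smul_of_norm_eq_one h3e he0 σ₀ σ₁ hinteg h3 he ht q hz' hn1
    have hback : q.liftHom z = η • q.liftHom (η' • z) := by
      rw [map_smul, smul_smul, hηη, one_smul]
    refine ⟨η * r, m, ?_⟩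
    rw [hback]
    exact h.imp (fun h => by rw [h, smul_smul]) (fun h => by rw [h, smul_smul])
  rcases Int.even_or_odd' k with ⟨l, rfl | rfl⟩
  · exact heven z l hz (by rw [hn, two_mul])
  · set y : ℍ[F, -algebraMap (𝓞 F) F ε, t, -1] := ⟨t, -1, 0, 0⟩ with hy
    have hyI : y ∈ integralSubring he ht :=
      ⟨ht, isIntegral_one.neg, isIntegral_zero, isIntegral_zero⟩
    have hny : ((y * z) * star (y * z)).re =
        algebraMap (𝓞 F) F (ε ^ ((l + 1) + (l + 1)) : (𝓞 F)ˣ) := by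
      have h1 : algebraMap (𝓞 F) F (ε ^ ((l + 1) + (l + 1)) : (𝓞 F)ˣ) =
          algebraMap (𝓞 F) F ε * algebraMap (𝓞 F) F (ε ^ (2 * l + 1) : (𝓞 F)ˣ) := by
        rw [← map_mul, ← Units.val_mul, ← zpow_one_add]; congr 3; ring_nf
      rw [h1, ← hn, re_mul_star, re_mul_star]
      simp only [hy, QuaternionAlgebra.re_mul, QuaternionAlgebra.imI_mul,
        QuaternionAlgebra.imJ_mul, QuaternionAlgebra.imK_mul]
      ring
    obtain ⟨r, m, h⟩ := heven (y * z) (l + 1) (mul_mem hyI hz) hny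
    have hqy : q.liftHom y = t • 1 - q.i := by
      simp [hy, QuaternionAlgebra.Basis.liftHom_apply, QuaternionAlgebra.Basis.lift,
        Algebra.algebraMap_eq_smul_one, sub_eq_add_neg]
    have hiy : q.i * q.liftHom y = algebraMap (𝓞 F) F ε • 1 := by
      rw [hqy, mul_sub, q.i_mul_i, mul_smul_comm, mul_one]; module
    have hback : q.liftHom z = (algebraMap (𝓞 F) F ε)⁻¹ • (q.i * q.liftHom (y * z)) := by
      rw [map_mul, ← mul_assoc, hiy, smul_mul_assoc, one_mul, smul_smul, inv_mul_cancel₀ he0,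
        one_smul]
    refine ⟨(algebraMap (𝓞 F) F ε)⁻¹ * r, m + 1, ?_⟩
    rw [hback, pow_succ']
    refine h.imp (fun h => ?_) (fun h => ?_)
    · rw [h, mul_smul_comm, smul_smul]
    · rw [h, mul_smul_comm, smul_smul, mul_assoc]

end BasisOrderUnits

section DihedralUnits

/-- A group generated by an element of order six and an involution inverting it is dihedral. -/
lemma nonempty_mulEquiv_dihedralGroup_six {G : Type*} [Group G] {x y : G} (hx6 : x ^ 6 = 1)
    (hx2 : x ^ 2 ≠ 1) (hx3 : x ^ 3 ≠ 1) (hy : y ^ 2 = 1) (hxy : x * y * x = y)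
    (hne : ∀ m : ℕ, x ^ m ≠ y) (hall : ∀ g : G, ∃ m : ℕ, g = x ^ m ∨ g = x ^ m * y) :
    Nonempty (G ≃* DihedralGroup 6) := by
  let g : ZMod 6 →+ Additive G := ZMod.lift 6 ⟨zmultiplesHom (Additive G) (Additive.ofMul x), by
    change ((6 : ℕ) : ℤ) • Additive.ofMul x = 0
    rw [natCast_zsmul, ← ofMul_pow, hx6, ofMul_one]⟩
  let f : ZMod 6 → G := fun i => (g i).toMul
  have hf1 : ∀ m : ℕ, f m = x ^ m := fun m => by
    have h : g ((m : ℤ) : ZMod 6) = _ := ZMod.lift_coe 6 _ (m : ℤ)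
    rw [Int.cast_natCast] at h
    simp only [f, h]
    change Additive.toMul ((m : ℤ) • Additive.ofMul x) = _
    rw [natCast_zsmul, ← ofMul_pow, toMul_ofMul]
  have hfadd : ∀ i j, f (i + j) = f i * f j := fun i j => by simp [f]
  have hf0 : f 0 = 1 := by simp [f]
  have hfsub : ∀ i j, f (i - j) = f i * (f j)⁻¹ := fun i j => by simp [f, div_eq_mul_inv]
  have hpow : ∀ m : ℕ, x ^ m * y * x ^ m = y := by
    intro m
    induction m with
    | zero => simp
    | succ k ih =>
      calc x ^ (k + 1) * y * x ^ (k + 1) = x ^ k * (x * y * x) * x ^ k := by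
            simp only [mul_assoc, ← pow_succ', pow_succ x k]
        _ = y := by rw [hxy, ih]
  have hfm : ∀ i, ∃ m : ℕ, f i = x ^ m := fun i => ⟨i.val, by rw [← hf1, ZMod.natCast_zmod_val]⟩
  have hyf : ∀ i, f i * y = y * (f i)⁻¹ := fun i => by
    obtain ⟨m, hm⟩ := hfm i
    rw [hm, eq_mul_inv_iff_mul_eq, hpow]
  let Φ : DihedralGroup 6 →* G :=
    { toFun := fun d => match d with
        | .r i => f i
        | .sr i => y * f i
      map_one' := hf0
      map_mul' := by
        rintro (i | i) (j | j)
        · rw [DihedralGroup.r_mul_r]; exact hfadd i j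
        · rw [DihedralGroup.r_mul_sr]
          change y * f (j - i) = f i * (y * f j)
          rw [← mul_assoc, hyf, hfsub, mul_assoc, ← hfsub, sub_eq_neg_add, hfadd]
          congr 2
          rw [← zero_sub, hfsub, hf0, one_mul]
        · rw [DihedralGroup.sr_mul_r]
          change y * f (i + j) = y * f i * f j
          rw [hfadd, mul_assoc]
        · rw [DihedralGroup.sr_mul_sr]
          change f (j - i) = y * f i * (y * f j)
          have : y * f i * (y * f j) = y * (f i * y) * f j := by group
          rw [this, hyf, ← mul_assoc, ← pow_two, hy, one_mul, sub_eq_neg_add, hfadd]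
          congr 1
          rw [← zero_sub, hfsub, hf0, one_mul] }
  have hord : orderOf x = 6 := by
    have h := orderOf_dvd_of_pow_eq_one hx6
    have h2 : ¬ orderOf x ∣ 2 := fun h => hx2 (orderOf_dvd_iff_pow_eq_one.1 h)
    have h3 : ¬ orderOf x ∣ 3 := fun h => hx3 (orderOf_dvd_iff_pow_eq_one.1 h)
    have hle := Nat.le_of_dvd (by norm_num) h
    interval_cases orderOf x <;> revert h h2 h3 <;> decide
  have hinj : Function.Injective Φ := by
    rw [injective_iff_map_eq_one]
    rintro (i | i) h
    · change f i = 1 at h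
      rw [← ZMod.natCast_zmod_val i, hf1, ← orderOf_dvd_iff_pow_eq_one, hord,
        ← ZMod.natCast_eq_zero_iff, ZMod.natCast_zmod_val] at h
      rw [h, DihedralGroup.one_def]
    · change y * f i = 1 at h
      obtain ⟨m, hm⟩ := hfm (-i)
      exfalso
      apply hne m
      rw [← hm, ← zero_sub, hfsub, hf0, one_mul, inv_eq_of_mul_eq_one_left h]
  have hsurj : Function.Surjective Φ := by
    intro a
    obtain ⟨m, rfl | rfl⟩ := hall a
    · exact ⟨.r m, hf1 m⟩
    · refine ⟨.sr (-m), ?_⟩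
      change y * f (-m) = _
      rw [← hf1, hyf, ← zero_sub, hfsub, hf0, one_mul]
  exact ⟨(MulEquiv.ofBijective Φ ⟨hinj, hsurj⟩).symm⟩

variable {F} {H : Type} [Ring H] [Algebra F H]

omit [NumberField F] in
lemma redUnitIso_dihedralGroup_six [Nontrivial H] {O : Subring H} (hO : IsOrder F O)
    (u w : (↥O)ˣ) (hu6 : ∃ r : F, ((u : O) : H) ^ 6 = r • 1)
    (hu2 : ∀ r : F, ((u : O) : H) ^ 2 ≠ r • 1) (hu3 : ∀ r : F, ((u : O) : H) ^ 3 ≠ r • 1)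
    (hw : ∃ r : F, ((w : O) : H) ^ 2 = r • 1)
    (huw : ∃ r : F, ((u : O) : H) * (w : O) * (u : O) = r • ((w : O) : H))
    (hne : ∀ (m : ℕ) (r : F), ((w : O) : H) ≠ r • ((u : O) : H) ^ m)
    (hall : ∀ g : (↥O)ˣ, ∃ (r : F) (m : ℕ), ((g : O) : H) = r • ((u : O) : H) ^ m ∨
      ((g : O) : H) = r • (((u : O) : H) ^ m * (w : O))) :
    RedUnitIso F O (DihedralGroup 6) := by
  let c : (↥O)ˣ → H := fun v => ((v : O) : H)
  have cmul : ∀ a b, c (a * b) = c a * c b := fun _ _ => rfl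
  have cone : c 1 = 1 := rfl
  have cinv : ∀ a, c a * c a⁻¹ = 1 := fun a => by rw [← cmul, mul_inv_cancel, cone]
  have cinv' : ∀ a, c a⁻¹ * c a = 1 := fun a => by rw [← cmul, inv_mul_cancel, cone]
  have scal_inv : ∀ (a : (↥O)ˣ) (r : F), c a = r • 1 → c a⁻¹ = r⁻¹ • 1 := fun a r h => by
    have h1 := cinv a
    rw [h, smul_mul_assoc, one_mul] at h1
    have hr : r ≠ 0 := by
      rintro rfl
      rw [zero_smul] at h1
      exact zero_ne_one h1
    rw [← h1, smul_smul, inv_mul_cancel₀ hr, one_smul]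
  let Z : Subgroup (↥O)ˣ :=
    { carrier := {v | ∃ r : F, c v = r • 1}
      one_mem' := ⟨1, by rw [cone, one_smul]⟩
      mul_mem' := by
        rintro a b ⟨r, hr⟩ ⟨s, hs⟩
        exact ⟨r * s, by rw [cmul, hr, hs, smul_mul_smul_comm, one_mul]⟩
      inv_mem' := by
        rintro a ⟨r, hr⟩
        exact ⟨r⁻¹, scal_inv a r hr⟩ }
  have hZ : Z.Normal := ⟨by
    rintro a ⟨r, hr⟩ g
    refine ⟨r, ?_⟩
    rw [cmul, cmul, hr, mul_smul_comm, mul_one, smul_mul_assoc, cinv]⟩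
  have hmk : ∀ a b : (↥O)ˣ, (QuotientGroup.mk' Z a = QuotientGroup.mk' Z b) ↔
      ∃ r : F, c a = r • c b := by
    intro a b
    rw [eq_comm, QuotientGroup.mk'_apply, QuotientGroup.mk'_apply, QuotientGroup.eq]
    constructor
    · rintro ⟨r, hr⟩
      refine ⟨r, ?_⟩
      rw [cmul] at hr
      rw [← one_mul (c a), ← cinv b, mul_assoc, hr, mul_smul_comm, mul_one]
    · rintro ⟨r, hr⟩
      refine ⟨r, ?_⟩
      rw [cmul, hr, mul_smul_comm, cinv']
  have cpow : ∀ (a : (↥O)ˣ) (m : ℕ), c (a ^ m) = c a ^ m := fun a m => by simp [c]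
  obtain ⟨e⟩ := nonempty_mulEquiv_dihedralGroup_six (x := QuotientGroup.mk' Z u)
    (y := QuotientGroup.mk' Z w)
    (by rw [← map_pow, ← map_one (QuotientGroup.mk' Z), hmk, cpow, cone]; exact hu6)
    (by
      rw [← map_pow, ← map_one (QuotientGroup.mk' Z), Ne, hmk, cpow, cone]
      exact fun ⟨r, h⟩ => hu2 r h)
    (by
      rw [← map_pow, ← map_one (QuotientGroup.mk' Z), Ne, hmk, cpow, cone]
      exact fun ⟨r, h⟩ => hu3 r h)
    (by rw [← map_pow, ← map_one (QuotientGroup.mk' Z), hmk, cpow, cone]; exact hw)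
    (by rw [← map_mul, ← map_mul, hmk, cmul, cmul]; exact huw)
    (by
      intro m
      rw [← map_pow, Ne, eq_comm, hmk, cpow]
      exact fun ⟨r, h⟩ => hne m r h)
    (by
      intro g
      obtain ⟨g, rfl⟩ := QuotientGroup.mk'_surjective Z g
      obtain ⟨r, m, h⟩ := hall g
      refine ⟨m, h.imp (fun h => ?_) (fun h => ?_)⟩
      · rw [← map_pow, hmk, cpow]; exact ⟨r, h⟩
      · rw [← map_pow, ← map_mul, hmk, cmul, cpow]; exact ⟨r, h⟩)
  refine ⟨e.toMonoidHom.comp (QuotientGroup.mk' Z),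
    e.surjective.comp (QuotientGroup.mk'_surjective Z), fun v => ?_⟩
  rw [isScalarUnit_iff hO, MonoidHom.comp_apply, MulEquiv.coe_toMonoidHom, map_eq_one_iff e
    e.injective, ← map_one (QuotientGroup.mk' Z), hmk, cone]
  simp only [Algebra.algebraMap_eq_smul_one]
  rfl

lemma redUnitIso_basisOrder {ε : (𝓞 F)ˣ} {E t : F}
    (hE : algebraMap (𝓞 F) F ε = E)     (h3e : 3 * E = t ^ 2) (σ₀ σ₁ : F →+* ℝ)
    (hinteg : ∀ x : F, IsIntegral ℤ x → |σ₀ x| ≤ 2 → |σ₁ x| ≤ 2 →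
      x = 0 ∨ x = 1 ∨ x = -1 ∨ x = 2 ∨ x = -2)
    (h3 : ∀ x : F, x ^ 2 ≠ 3)
    (hpos : ∀ v : (𝓞 F)ˣ, 0 < σ₀ (algebraMap (𝓞 F) F v) → ∃ k : ℤ, v = ε ^ k)
    (he : IsIntegral ℤ E) (ht : IsIntegral ℤ t)
    (q : QuaternionAlgebra.Basis H (-E) t (-1))
    (hq : Function.Bijective q.liftHom) :
    RedUnitIso F (basisOrder he ht q) (DihedralGroup 6) := by
  have : Nontrivial H := hq.1.nontrivial
  have hO := isOrder_basisOrder he ht q hq.2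
  have he0 : E ≠ 0 := by rw [← hE]; simp
  have ht0 : t ≠ 0 := by
    rintro rfl
    apply he0
    have h := congrArg σ₀ h3e
    simp only [map_mul, map_ofNat, map_pow, map_zero] at h
    rw [← map_eq_zero σ₀]; nlinarith
  have hi := q.i_mul_i
  have hji : q.j * q.i = t • q.j - q.i * q.j := by rw [q.j_mul_i, q.i_mul_j]
  have hjj : q.j * q.j = -1 := by rw [q.j_mul_j]; simp
  set E' : F := algebraMap (𝓞 F) F (ε⁻¹ : (𝓞 F)ˣ) with hE'
  have hEE : E * E' = 1 := by rw [← hE, hE', ← map_mul, ← Units.val_mul]; simp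
  have hE'O : algebraMap F H E' ∈ basisOrder he ht q := hO.1 ⟨_, rfl⟩
  have htO : algebraMap F H t ∈ basisOrder he ht q := hO.1 ⟨⟨t, ht⟩, rfl⟩
  have hiO := i_mem_basisOrder he ht q
  have hjO := j_mem_basisOrder he ht q
  have hns : ∀ r : F, q.i ≠ algebraMap F H r := by
    intro r hr
    have h1 : q.liftHom ⟨0, 1, 0, 0⟩ = q.liftHom ⟨r, 0, 0, 0⟩ := by
      simp [QuaternionAlgebra.Basis.liftHom_apply, QuaternionAlgebra.Basis.lift, hr]
    have := congrArg QuaternionAlgebra.imI (hq.1 h1)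
    simp at this
  let u : (↥(basisOrder he ht q))ˣ :=
    ⟨⟨q.i, hiO⟩, ⟨algebraMap F H E' * (algebraMap F H t - q.i), mul_mem hE'O (sub_mem htO hiO)⟩,
      Subtype.ext (by
        change q.i * (algebraMap F H E' * (algebraMap F H t - q.i)) = 1
        rw [← mul_assoc, ← Algebra.commutes E', mul_assoc, mul_sub, hi, ← Algebra.commutes t,
          ← Algebra.smul_def, ← Algebra.smul_def]
        linear_combination (norm := module) hEE • (1 : H)),
      Subtype.ext (by
        change algebraMap F H E' * (algebraMap F H t - q.i) * q.i = 1
        rw [mul_assoc, sub_mul, hi, ← Algebra.smul_def, ← Algebra.smul_def]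
        linear_combination (norm := module) hEE • (1 : H))⟩
  let w : (↥(basisOrder he ht q))ˣ :=
    ⟨⟨q.j, hjO⟩, ⟨-q.j, neg_mem hjO⟩, Subtype.ext (by
        change q.j * -q.j = 1
        rw [mul_neg, hjj, neg_neg]), Subtype.ext (by
        change -q.j * q.j = 1
        rw [neg_mul, hjj, neg_neg])⟩
  have hi3 : q.i ^ 3 = (2 * E) • q.i - (t * E) • 1 := by
    rw [pow_succ, pow_two, hi, add_mul, smul_mul_assoc, smul_mul_assoc, one_mul, hi]
    linear_combination (norm := module) -h3e • q.i
  have h20 : (2 : F) ≠ 0 := by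
    intro h
    have := congrArg σ₀ h
    rw [map_ofNat, map_zero] at this
    norm_num at this
  refine redUnitIso_dihedralGroup_six hO u w ⟨-E ^ 3, ?_⟩ ?_ ?_ ⟨-1, ?_⟩ ⟨E, ?_⟩ ?_ ?_
  · change q.i ^ 6 = _
    rw [show q.i ^ 6 = q.i ^ 3 * q.i ^ 3 by rw [← pow_add], hi3]
    simp only [mul_sub, sub_mul, smul_mul_assoc, mul_smul_comm, one_mul, mul_one, hi]
    linear_combination (norm := module) (-E ^ 2) • h3e • (1 : H)
  · intro r h
    change q.i ^ 2 = _ at h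
    rw [pow_two, hi, add_comm, ← Algebra.algebraMap_eq_smul_one r] at h
    exact ht0 (coeff_eq_zero_of_scalar hns h)
  · intro r h
    change q.i ^ 3 = _ at h
    rw [hi3, sub_eq_add_neg, ← neg_smul, ← Algebra.algebraMap_eq_smul_one r] at h
    exact mul_ne_zero h20 he0 (coeff_eq_zero_of_scalar hns h)
  · change q.j ^ 2 = _
    rw [pow_two, hjj, neg_smul, one_smul]
  · change q.i * q.j * q.i = E • q.j
    rw [mul_assoc, hji, mul_sub, ← mul_assoc, hi, add_mul, smul_mul_assoc, smul_mul_assoc, one_mul,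
      mul_smul_comm]
    module
  · intro m r h
    change q.j = r • q.i ^ m at h
    have hc : q.j * q.i = q.i * q.j := by
      rw [h, smul_mul_assoc, mul_smul_comm, ← pow_succ, ← pow_succ']
    rw [hji, sub_eq_iff_eq_add] at hc
    have h1 : t • (1 : H) = q.i + q.i := by
      have := congrArg (fun x => -(x * q.j)) hc
      simpa [add_mul, mul_assoc, hjj] using this
    have h2 : (2 : F) • q.i + (0 : F) • (1 : H) = algebraMap F H t := by
      rw [Algebra.algebraMap_eq_smul_one, h1]; module
    exact h20 (coeff_eq_zero_of_scalar hns h2)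
  · intro g
    obtain ⟨z, hz, hzg⟩ := mem_basisOrder.1 (g : basisOrder he ht q).2
    obtain ⟨T, hT, hTe⟩ := exists_isRedTrace (AlgEquiv.ofBijective q.liftHom hq).symm
    have hTz : T (q.liftHom z) = 2 * z.re + t * z.imI := by
      rw [hTe, show (AlgEquiv.ofBijective q.liftHom hq).symm (q.liftHom z) = z from
        (AlgEquiv.ofBijective q.liftHom hq).symm_apply_apply z]
    have hquad : q.liftHom z * q.liftHom z =
        T (q.liftHom z) • q.liftHom z - algebraMap F H (z * star z).re := by
      rw [hTz, ← map_mul, ← map_smul, ← AlgHom.commutes q.liftHom, ← map_sub]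
      congr 1
      rw [QuaternionAlgebra.coe_algebraMap, ← QuaternionAlgebra.mul_star_eq_coe]
      ext <;> simp <;> ring
    rw [hzg] at hquad
    obtain ⟨η, hη⟩ := exists_unit_eq_norm hT hO g hquad
    have hη0 : 0 < σ₀ (algebraMap (𝓞 F) F η) := by
      refine lt_of_le_of_ne ?_ ?_
      · rw [hη, re_mul_star, map_add]
        exact add_nonneg (form_nonneg h3e σ₀ _ _) (form_nonneg h3e σ₀ _ _)
      · rw [Ne, eq_comm, map_eq_zero]
        simp
    obtain ⟨k, rfl⟩ := hpos η hη0
    subst hE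
    obtain ⟨r, m, h⟩ := liftHom_eq_smul_of_norm_eq_zpow h3e σ₀ σ₁ hinteg h3 he ht q hz k hη.symm
    rw [hzg] at h
    exact ⟨r, m, h⟩

end DihedralUnits

section Conclusion

variable {F} {H : Type} [Ring H] [Algebra F H]

omit [NumberField F] in
lemma conjRel_basisOrder {E t : F} (h3e : 3 * E = t ^ 2) (he0 : E ≠ 0) (σ : F →+* ℝ)
    (hfin : Module.finrank F H = 4) (he : IsIntegral ℤ E) (ht : IsIntegral ℤ t)
    (q q' : QuaternionAlgebra.Basis H (-E) t (-1)) :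
    ConjRel (basisOrder he ht q) (basisOrder he ht q') := by
  have hN := eq_zero_of_re_mul_star h3e he0 σ
  have hq := bijective_liftHom q hfin hN
  obtain ⟨x, hx⟩ := exists_conj_basis q q' (fun y hy => isUnit_of_bijective_liftHom q hq hN hy)
    (fun p h => by
      have h1 : p.liftHom ⟨0, 2, 0, 0⟩ = p.liftHom ⟨t, 0, 0, 0⟩ := by
        simpa [QuaternionAlgebra.Basis.liftHom_apply, QuaternionAlgebra.Basis.lift,
          Algebra.algebraMap_eq_smul_one] using h
      have h2 := congrArg QuaternionAlgebra.imI ((bijective_liftHom p hfin hN).1 h1)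
      have h3 := congrArg σ h2
      simp only [map_ofNat, map_zero] at h3
      norm_num at h3)
  refine ⟨x, fun y => ⟨fun hy => ?_, fun hy => ?_⟩⟩
  · obtain ⟨z, hz, rfl⟩ := mem_basisOrder.1 hy
    refine mem_basisOrder.2 ⟨z, hz, ?_⟩
    rw [hx, mul_assoc, Units.mul_inv, mul_one]
  · obtain ⟨z, hz, hzy⟩ := mem_basisOrder.1 hy
    refine mem_basisOrder.2 ⟨z, hz, ?_⟩
    have h1 : (x : H) * q.liftHom z = x * y := by
      rw [hx, hzy, mul_assoc, Units.inv_mul, mul_one]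
    exact x.isUnit.mul_left_cancel h1

/-- The basis obtained by negating the first generator. -/
def negBasis {E t : F} (q : QuaternionAlgebra.Basis H (-E) (-t) (-1)) :
    QuaternionAlgebra.Basis H (-E) t (-1) where
  i := -q.i
  j := q.j
  k := -q.k
  i_mul_i := by rw [neg_mul_neg, q.i_mul_i, neg_smul t, smul_neg]
  j_mul_j := q.j_mul_j
  i_mul_j := by rw [neg_mul, q.i_mul_j]
  j_mul_i := by rw [mul_neg, q.j_mul_i]; module

/-- A quaternion basis of `ℍ[F, -1, -3]` whose first generator has reduced norm `E`. -/
def dihedralBasis [CharZero F] {E t : F} (h3e : 3 * E = t ^ 2) :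
    QuaternionAlgebra.Basis ℍ[F, -1, -3] (-E) t (-1) where
  i := ⟨t / 2, 0, t / 6, 0⟩
  j := ⟨0, 1, 0, 0⟩
  k := ⟨t / 2, 0, t / 6, 0⟩ * ⟨0, 1, 0, 0⟩
  i_mul_i := by
    ext <;> simp
    · linear_combination (1 / 3 : F) * h3e
    · ring
  j_mul_j := by ext <;> simp
  i_mul_j := rfl
  j_mul_i := by
    ext <;> simp
    ring

/-- The standard quaternion basis attached to a basis containing a generator of order twelve. -/
def standardBasis {E t : F} (h3e : 3 * E = t ^ 2) (ht0 : t ≠ 0)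
    (q : QuaternionAlgebra.Basis H (-E) t (-1)) : QuaternionAlgebra.Basis H (-1 : F) 0 (-3) where
  i := q.j
  j := (6 / t) • q.i - (3 : F) • 1
  k := q.j * ((6 / t) • q.i - (3 : F) • 1)
  i_mul_i := by rw [q.j_mul_j, zero_smul, add_zero]
  j_mul_j := by
    have h : (6 / t) * t = 6 := div_mul_cancel₀ 6 ht0
    simp only [sub_mul, mul_sub, smul_mul_assoc, mul_smul_comm, one_mul, mul_one, q.i_mul_i]
    linear_combination (norm := module)
      (-(6 / t) ^ 2 / 3) • h3e • (1 : H) - ((6 / t * t + 6) / 3) • h • (1 : H) +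
        (6 / t) • h • q.i
  i_mul_j := rfl
  j_mul_i := by
    have h : (6 / t) * t = 6 := div_mul_cancel₀ 6 ht0
    simp only [sub_mul, mul_sub, smul_mul_assoc, mul_smul_comm, one_mul, mul_one, q.i_mul_j,
      q.j_mul_i]
    linear_combination (norm := module) h • q.j

omit [NumberField F] in
lemma eq_zero_of_re_mul_star_standard (σ : F →+* ℝ) (z : ℍ[F, -1, -3])
    (hz : (z * star z).re = 0) : z = 0 := by
  have h : z.re ^ 2 + z.imI ^ 2 + 3 * z.imJ ^ 2 + 3 * z.imK ^ 2 = 0 := by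
    refine Eq.trans ?_ hz
    simp only [QuaternionAlgebra.re_mul, QuaternionAlgebra.re_star, QuaternionAlgebra.imI_star,
      QuaternionAlgebra.imJ_star, QuaternionAlgebra.imK_star]
    ring
  have h1 := congrArg σ h
  simp only [map_add, map_mul, map_pow, map_ofNat, map_zero] at h1
  have key : ∀ {x : F}, σ x ^ 2 ≤ 0 → x = 0 := fun hx =>
    (map_eq_zero σ).1 (pow_eq_zero_iff two_ne_zero |>.1 (le_antisymm hx (sq_nonneg _)))
  have g1 := sq_nonneg (σ z.re)
  have g2 := sq_nonneg (σ z.imI)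
  have g3 := sq_nonneg (σ z.imJ)
  have g4 := sq_nonneg (σ z.imK)
  ext
  · exact key (by linarith)
  · exact key (by linarith)
  · exact key (by linarith)
  · exact key (by linarith)

lemma exists_eq_basisOrder {T : H →ₗ[F] F} (hT : IsRedTrace T) (hfin : Module.finrank F H = 4)
    (hdef : TotallyDefinite F H) (h3 : ∀ x : F, x ^ 2 ≠ 3) (σ₀ : F →+* ℝ) {ε : (𝓞 F)ˣ}
    (hε : 1 < σ₀ (algebraMap (𝓞 F) F ↑ε))
    (hεfund : ∀ u : (𝓞 F)ˣ, 1 < σ₀ (algebraMap (𝓞 F) F ↑u) →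
      σ₀ (algebraMap (𝓞 F) F ↑ε) ≤ σ₀ (algebraMap (𝓞 F) F ↑u))
    {E t : F} (hE : algebraMap (𝓞 F) F ε = E) (h3e : 3 * E = t ^ 2) (he : IsIntegral ℤ E)
    (ht : IsIntegral ℤ t) {O : Subring H} (hO : IsMaximalOrder F O)
    (hG : RedUnitIso F O (DihedralGroup 6)) :
    ∃ q : QuaternionAlgebra.Basis H (-E) t (-1), O = basisOrder he ht q := by
  have : Nontrivial H := Module.nontrivial_of_finrank_pos (R := F) (by omega)
  obtain ⟨t', h3e', q', hi, hj⟩ := exists_basis_of_redUnitIso hT hdef h3 σ₀ hε hεfund hO.1 hG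
  subst hE
  have he0 : algebraMap (𝓞 F) F ε ≠ 0 := by simp
  have he' : IsIntegral ℤ (algebraMap (𝓞 F) F ε)⁻¹ := by
    rw [← eq_inv_of_mul_eq_one_left (a := algebraMap (𝓞 F) F (ε⁻¹ : (𝓞 F)ˣ))
      (by rw [← map_mul, ← Units.val_mul]; simp)]
    exact RingOfIntegers.isIntegral_coe _
  obtain ⟨q, hi, hj⟩ : ∃ q : QuaternionAlgebra.Basis H (-algebraMap (𝓞 F) F ε) t (-1),
      q.i ∈ O ∧ q.j ∈ O := by
    obtain rfl | rfl := sq_eq_sq_iff_eq_or_eq_neg.1 (h3e'.symm.trans h3e)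
    · exact ⟨q', hi, hj⟩
    · exact ⟨negBasis q', neg_mem hi, hj⟩
  have hq := bijective_liftHom q hfin (eq_zero_of_re_mul_star h3e he0 σ₀)
  exact ⟨q, (isMaximalOrder_basisOrder he ht he' he0 h3e q hq).2 O hO.1
    (basisOrder_le hO.1.1 hi hj)⟩

end Conclusion

/-- **Refined type number for `D₆`** -/
theorem typeNum_dihedral_six
    (d : ℕ) (hd6 : 6 ≤ d) (hdsf : Squarefree d)
    (sqrtd : F) (hsqrtd : sqrtd ^ 2 = (d : F))
    (hgen : Algebra.adjoin ℚ {sqrtd} = ⊤)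
    (σ₀ : F →+* ℝ) (hσ₀ : 0 < σ₀ sqrtd)
    -- `ε` is the fundamental unit of `F`: the smallest unit greater than `1`
    (ε : (𝓞 F)ˣ) (hε : 1 < σ₀ (algebraMap (𝓞 F) F ↑ε))
    (hεfund : ∀ u : (𝓞 F)ˣ, 1 < σ₀ (algebraMap (𝓞 F) F ↑u) →
      σ₀ (algebraMap (𝓞 F) F ↑ε) ≤ σ₀ (algebraMap (𝓞 F) F ↑u))
    (H : Type) [Ring H] [Algebra F H]
    (hquat : IsQuatAlg F H) (hdef : TotallyDefinite F H) :
    (Nonempty (H ≃ₐ[F] ℍ[F, -1, -3]) ∧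
        (∃ t : F, 3 * algebraMap (𝓞 F) F ↑ε = t ^ 2) →
      typeNum F H (DihedralGroup 6) = 1) ∧
    (¬(Nonempty (H ≃ₐ[F] ℍ[F, -1, -3]) ∧
        (∃ t : F, 3 * algebraMap (𝓞 F) F ↑ε = t ^ 2)) →
      typeNum F H (DihedralGroup 6) = 0) := by
  have hfin := finrank_eq_four hquat
  obtain ⟨a, b, -, -, ⟨e⟩⟩ := id hquat
  obtain ⟨T, hT, -⟩ := exists_isRedTrace e
  have h3 := three_ne_sq hd6 hdsf hsqrtd hgen
  obtain ⟨s, hs⟩ := exists_conj hd6 hdsf hsqrtd hgen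
  have hinteg : ∀ x : F, IsIntegral ℤ x → |σ₀ x| ≤ 2 → |(σ₀.comp s) x| ≤ 2 →
      x = 0 ∨ x = 1 ∨ x = -1 ∨ x = 2 ∨ x = -2 := fun x hx h h' =>
    integral_of_abs_le_two hd6 hdsf hsqrtd hgen σ₀ hs hx h h'
  have : Nontrivial H := Module.nontrivial_of_finrank_pos (R := F) (by omega)
  constructor
  · rintro ⟨⟨e₀⟩, t, h3e⟩
    obtain ⟨E, hE⟩ : ∃ E, algebraMap (𝓞 F) F ε = E := ⟨_, rfl⟩
    rw [hE] at h3e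
    have he0 : E ≠ 0 := by rw [← hE]; simp
    have he : IsIntegral ℤ E := by rw [← hE]; exact RingOfIntegers.isIntegral_coe _
    have he' : IsIntegral ℤ E⁻¹ := by
      rw [← eq_inv_of_mul_eq_one_left (a := algebraMap (𝓞 F) F (ε⁻¹ : (𝓞 F)ˣ))
        (by rw [← hE, ← map_mul, ← Units.val_mul]; simp)]
      exact RingOfIntegers.isIntegral_coe _
    have i3 : IsIntegral ℤ (3 : F) := by
      rw [show (3 : F) = 1 + 1 + 1 by norm_num]
      exact (isIntegral_one.add isIntegral_one).add isIntegral_one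
    have ht : IsIntegral ℤ t :=
      IsIntegral.of_pow two_pos (h3e ▸ i3.mul he)
    have hbij : ∀ q : QuaternionAlgebra.Basis H (-E) t (-1), Function.Bijective q.liftHom :=
      fun q => bijective_liftHom q hfin (eq_zero_of_re_mul_star h3e he0 σ₀)
    have hgood : ∀ q : QuaternionAlgebra.Basis H (-E) t (-1),
        IsMaximalOrder F (basisOrder he ht q) ∧
          RedUnitIso F (basisOrder he ht q) (DihedralGroup 6) := fun q =>
      ⟨isMaximalOrder_basisOrder he ht he' he0 h3e q (hbij q),
        redUnitIso_basisOrder hE h3e σ₀ (σ₀.comp s) hinteg h3 (eq_zpow_of_pos σ₀ hε hεfund) he ht q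
          (hbij q)⟩
    rw [typeNum, Nat.card_eq_one_iff_unique]
    refine ⟨⟨?_⟩, ⟨Quot.mk _ ⟨_, hgood ((dihedralBasis h3e).compHom e₀.symm.toAlgHom)⟩⟩⟩
    rintro ⟨O, hO, hG⟩ ⟨O', hO', hG'⟩
    apply Quot.sound
    obtain ⟨q, rfl⟩ := exists_eq_basisOrder hT hfin hdef h3 σ₀ hε hεfund hE h3e he ht hO hG
    obtain ⟨q', rfl⟩ := exists_eq_basisOrder hT hfin hdef h3 σ₀ hε hεfund hE h3e he ht hO' hG'
    exact conjRel_basisOrder h3e he0 σ₀ hfin he ht q q'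
  · intro hnot
    have hempty : IsEmpty {O : Subring H // IsMaximalOrder F O ∧
        RedUnitIso F O (DihedralGroup 6)} := by
      refine ⟨fun ⟨O, hO, hG⟩ => hnot ?_⟩
      obtain ⟨t, h3e, q, -, -⟩ := exists_basis_of_redUnitIso hT hdef h3 σ₀ hε hεfund hO.1 hG
      have ht0 : t ≠ 0 := by
        rintro rfl
        simp at h3e
      exact ⟨⟨(AlgEquiv.ofBijective (standardBasis h3e ht0 q).liftHom
        (bijective_liftHom _ hfin (eq_zero_of_re_mul_star_standard σ₀))).symm⟩, t, h3e⟩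
    rw [typeNum, Nat.card_eq_zero]
    left
    refine ⟨fun x => ?_⟩
    obtain ⟨y, _⟩ := Quot.exists_rep x
    exact hempty.false y

end QuatPaper
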